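/- arXiv:2506.21216 — 13 statements merged into one kernel-verified Lean document; each statement's English description precedes it below -/
import Mathlib

section
/- Let G be a finite simple graph and k ≥ 0 an integer. Let G' be the graph obtained from G by adding, for every vertex x of G, a new pendant vertex u_x adjacent only to x, and then adding k new isolated vertices. Then α(G') = |V(G)| + k, and G' has an edge clique cover with at most α(G') cliques if and only if G has an edge clique cover with at most k cliques. -/
def IsIndepFinset {V : Type*} (G : SimpleGraph V) (s : Finset V) : Prop :=
  (s : Set V).Pairwise fun u v => ¬ G.Adj u v

/-- `graphAlpha G` is the maximum size of an independent set of `G`. -/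
noncomputable def graphAlpha {V : Type*} [Fintype V] (G : SimpleGraph V) : ℕ :=
  sSup {n | ∃ s : Finset V, IsIndepFinset G s ∧ s.card = n}

/-- A family of cliques of `G` such that every edge of `G` has both endpoints in at
least one clique of the family. -/
def IsEdgeCliqueCover {V : Type*} (G : SimpleGraph V) (𝒞 : Finset (Finset V)) : Prop :=
  (∀ C ∈ 𝒞, G.IsClique (C : Set V)) ∧
    ∀ u v, G.Adj u v → ∃ C ∈ 𝒞, u ∈ C ∧ v ∈ C

/-- The graph obtained from `G` by adding, for every vertex `x` of `G` (here `Sum.inl x`),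
a new pendant vertex `u_x` (here `Sum.inr (Sum.inl x)`) adjacent only to `x`, and then
adding `k` new isolated vertices (here `Sum.inr (Sum.inr i)` for `i : Fin k`). -/
def pendIsoGraph {V : Type*} (G : SimpleGraph V) (k : ℕ) : SimpleGraph (V ⊕ (V ⊕ Fin k)) :=
  SimpleGraph.fromRel fun a b =>
    match a, b with
    | Sum.inl x, Sum.inl y => G.Adj x y
    | Sum.inl x, Sum.inr (Sum.inl y) => x = y
    | _, _ => False

namespace pendIsoGraph

variable {V : Type*} {G : SimpleGraph V} {k : ℕ}

@[simp]
lemma adj_inl_inl {x y : V} :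
    (pendIsoGraph G k).Adj (Sum.inl x) (Sum.inl y) ↔ G.Adj x y := by
  simp only [pendIsoGraph, SimpleGraph.fromRel_adj, ne_eq, Sum.inl.injEq, G.adj_comm y x, or_self,
    and_iff_right_iff_imp]
  exact fun h => h.ne

@[simp]
lemma adj_inl_pendant {x y : V} :
    (pendIsoGraph G k).Adj (Sum.inl x) (Sum.inr (Sum.inl y)) ↔ x = y := by
  simp [pendIsoGraph]

@[simp]
lemma adj_pendant_inl {x y : V} :
    (pendIsoGraph G k).Adj (Sum.inr (Sum.inl x)) (Sum.inl y) ↔ y = x := by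
  simp [pendIsoGraph]

@[simp]
lemma not_adj_inr_inr {a b : V ⊕ Fin k} :
    ¬ (pendIsoGraph G k).Adj (Sum.inr a) (Sum.inr b) := by
  simp [pendIsoGraph]

@[simp]
lemma not_adj_inl_isolated {x : V} {i : Fin k} :
    ¬ (pendIsoGraph G k).Adj (Sum.inl x) (Sum.inr (Sum.inr i)) := by
  simp [pendIsoGraph]

@[simp]
lemma not_adj_isolated_inl {x : V} {i : Fin k} :
    ¬ (pendIsoGraph G k).Adj (Sum.inr (Sum.inr i)) (Sum.inl x) := by
  simp [pendIsoGraph]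

/-- Collapsing each vertex with its pendant neighbor is injective on independent sets. -/
lemma card_le_of_isIndepFinset [Fintype V] {s : Finset (V ⊕ (V ⊕ Fin k))}
    (hs : IsIndepFinset (pendIsoGraph G k) s) : s.card ≤ Fintype.card V + k := by
  have hinj : Set.InjOn (Sum.elim Sum.inl id : V ⊕ (V ⊕ Fin k) → V ⊕ Fin k) s := by
    intro a ha b hb hab
    by_contra hne
    have hadj := hs ha hb hne
    rcases a with x | x | i <;> rcases b with y | y | j <;> simp_all
  simpa using Finset.card_le_card_of_injOn _ (fun a _ => Finset.mem_univ _) hinj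

lemma graphAlpha_eq [Fintype V] :
    graphAlpha (pendIsoGraph G k) = Fintype.card V + k := by
  refine IsGreatest.csSup_eq ⟨⟨Finset.univ.map Function.Embedding.inr, ?_, by simp⟩, ?_⟩
  · intro a ha b hb _
    simp only [Finset.coe_map, Set.mem_image] at ha hb
    obtain ⟨a, -, rfl⟩ := ha
    obtain ⟨b, -, rfl⟩ := hb
    exact not_adj_inr_inr
  · rintro n ⟨s, hs, rfl⟩
    exact card_le_of_isIndepFinset hs

lemma eq_of_pendant_mem_clique {C : Finset (V ⊕ (V ⊕ Fin k))}
    (hC : (pendIsoGraph G k).IsClique (C : Set (V ⊕ (V ⊕ Fin k)))) {x y : V}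
    (hx : Sum.inl x ∈ C) (hy : Sum.inr (Sum.inl y) ∈ C) : x = y :=
  adj_inl_pendant.1 (hC hx hy Sum.inl_ne_inr)

/-- Discarding from a cover of `pendIsoGraph G k` the cliques that cover the pendant edges
leaves a cover of `G`. -/
lemma exists_cover_of_cover [Fintype V] [DecidableEq V] {𝒞 : Finset (Finset (V ⊕ (V ⊕ Fin k)))}
    (h𝒞 : IsEdgeCliqueCover (pendIsoGraph G k) 𝒞) (hcard : 𝒞.card ≤ Fintype.card V + k) :
    ∃ 𝒟 : Finset (Finset V), IsEdgeCliqueCover G 𝒟 ∧ 𝒟.card ≤ k := by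
  obtain ⟨hcl, hcov⟩ := h𝒞
  choose D hD hDx hDu using fun x : V => hcov (Sum.inl x) (Sum.inr (Sum.inl x)) (by simp)
  have hinj : Function.Injective D := fun x y hxy =>
    eq_of_pendant_mem_clique (hcl _ (hD y)) (hxy ▸ hDx x) (hDu y)
  refine ⟨(𝒞 \ Finset.univ.image D).image Finset.toLeft, ⟨?_, ?_⟩, ?_⟩
  · intro C hC
    obtain ⟨C, hC', rfl⟩ := Finset.mem_image.1 hC
    intro x hx y hy hne
    simp only [Finset.mem_coe, Finset.mem_toLeft] at hx hy
    exact adj_inl_inl.1 (hcl C (Finset.mem_sdiff.1 hC').1 hx hy (by simpa using hne))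
  · intro x y hxy
    obtain ⟨C, hC, hx, hy⟩ := hcov (Sum.inl x) (Sum.inl y) (adj_inl_inl.2 hxy)
    refine ⟨C.toLeft, Finset.mem_image_of_mem _ (Finset.mem_sdiff.2 ⟨hC, ?_⟩), by simpa, by simpa⟩
    intro hCD
    obtain ⟨z, -, rfl⟩ := Finset.mem_image.1 hCD
    exact hxy.ne ((eq_of_pendant_mem_clique (hcl _ hC) hx (hDu z)).trans
      (eq_of_pendant_mem_clique (hcl _ hC) hy (hDu z)).symm)
  · have hsub : Finset.univ.image D ⊆ 𝒞 := by
      simpa [Finset.image_subset_iff] using hD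
    have hcardD : (Finset.univ.image D).card = Fintype.card V := by
      rw [Finset.card_image_of_injective _ hinj, Finset.card_univ]
    have := Finset.card_sdiff_add_card_eq_card hsub
    exact Finset.card_image_le.trans (by omega)

/-- Adding the pendant edges to a cover of `G` gives a cover of `pendIsoGraph G k`. -/
lemma exists_cover_of_cover_base [Fintype V] [DecidableEq V] {𝒞 : Finset (Finset V)}
    (h𝒞 : IsEdgeCliqueCover G 𝒞) (hcard : 𝒞.card ≤ k) :
    ∃ 𝒟 : Finset (Finset (V ⊕ (V ⊕ Fin k))),
      IsEdgeCliqueCover (pendIsoGraph G k) 𝒟 ∧ 𝒟.card ≤ Fintype.card V + k := by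
  obtain ⟨hcl, hcov⟩ := h𝒞
  have hpend (x : V) : ({Sum.inl x, Sum.inr (Sum.inl x)} : Finset (V ⊕ (V ⊕ Fin k))) ∈
      Finset.univ.image fun x : V =>
        ({Sum.inl x, Sum.inr (Sum.inl x)} : Finset (V ⊕ (V ⊕ Fin k))) :=
    Finset.mem_image_of_mem _ (Finset.mem_univ x)
  refine ⟨(Finset.univ.image fun x : V => {Sum.inl x, Sum.inr (Sum.inl x)}) ∪
    𝒞.image fun C => C.map Function.Embedding.inl, ⟨?_, ?_⟩, ?_⟩
  · intro C hC
    rcases Finset.mem_union.1 hC with hC | hC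
    · obtain ⟨x, -, rfl⟩ := Finset.mem_image.1 hC
      simp
    · obtain ⟨C, hC', rfl⟩ := Finset.mem_image.1 hC
      intro a ha b hb hne
      simp only [Finset.coe_map, Set.mem_image] at ha hb
      obtain ⟨x, hx, rfl⟩ := ha
      obtain ⟨y, hy, rfl⟩ := hb
      exact adj_inl_inl.2 (hcl C hC' hx hy fun h => hne (by rw [h]))
  · rintro (x | x | i) (y | y | j) hxy
    · obtain ⟨C, hC, hx, hy⟩ := hcov x y (adj_inl_inl.1 hxy)
      exact ⟨_, Finset.mem_union_right _ (Finset.mem_image_of_mem _ hC),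
        Finset.mem_map_of_mem _ hx, Finset.mem_map_of_mem _ hy⟩
    · obtain rfl := adj_inl_pendant.1 hxy
      exact ⟨_, Finset.mem_union_left _ (hpend x), by simp, by simp⟩
    · simp at hxy
    · obtain rfl := adj_pendant_inl.1 hxy
      exact ⟨_, Finset.mem_union_left _ (hpend y), by simp, by simp⟩
    all_goals simp at hxy
  · exact (Finset.card_union_le _ _).trans
      (add_le_add Finset.card_image_le (Finset.card_image_le.trans hcard))

end pendIsoGraph

/-- With `G'` obtained from `G` by adding a pendant neighbor to every vertex
and `k` isolated vertices, we have `α(G') = |V(G)| + k`, and `G'` has an edge clique cover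
with at most `α(G')` cliques iff `G` has an edge clique cover with at most `k` cliques. -/
theorem pendIso_alpha_and_cover {V : Type*} [Fintype V] [DecidableEq V]
    (G : SimpleGraph V) (k : ℕ) :
    graphAlpha (pendIsoGraph G k) = Fintype.card V + k ∧
      ((∃ 𝒞 : Finset (Finset (V ⊕ (V ⊕ Fin k))),
          IsEdgeCliqueCover (pendIsoGraph G k) 𝒞 ∧ 𝒞.card ≤ graphAlpha (pendIsoGraph G k)) ↔
        (∃ 𝒞 : Finset (Finset V), IsEdgeCliqueCover G 𝒞 ∧ 𝒞.card ≤ k)) := by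
  rw [pendIsoGraph.graphAlpha_eq]
  refine ⟨rfl, ?_, ?_⟩
  · rintro ⟨𝒞, h𝒞, hcard⟩
    exact pendIsoGraph.exists_cover_of_cover h𝒞 hcard
  · rintro ⟨𝒞, h𝒞, hcard⟩
    exact pendIsoGraph.exists_cover_of_cover_base h𝒞 hcard
end

section
/- Let G be a finite simple graph and let G' be the graph obtained from G by adding, for every vertex x of G, a new pendant vertex u_x adjacent only to x. Then α(G') = |V(G)| and ecp(G') = α(G') + ecp(G). -/
/-- An edge clique cover in which any two distinct cliques share at most one vertex. -/
def IsEdgeCliquePartition {V : Type*} [DecidableEq V] (G : SimpleGraph V)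
    (𝒞 : Finset (Finset V)) : Prop :=
  IsEdgeCliqueCover G 𝒞 ∧ ∀ C₁ ∈ 𝒞, ∀ C₂ ∈ 𝒞, C₁ ≠ C₂ → (C₁ ∩ C₂).card ≤ 1

/-- The minimum number of cliques in an edge clique partition of `G`. -/
noncomputable def ecpNum {V : Type*} [Fintype V] [DecidableEq V] (G : SimpleGraph V) : ℕ :=
  sInf {n | ∃ 𝒞 : Finset (Finset V), IsEdgeCliquePartition G 𝒞 ∧ 𝒞.card = n}

/-- The graph obtained from `G` by adding, for every vertex `x` of `G` (here `Sum.inl x`),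
a new pendant vertex `u_x` (here `Sum.inr x`) adjacent only to `x`. -/
def pendGraph {V : Type*} (G : SimpleGraph V) : SimpleGraph (V ⊕ V) :=
  SimpleGraph.fromRel fun a b =>
    match a, b with
    | Sum.inl x, Sum.inl y => G.Adj x y
    | Sum.inl x, Sum.inr y => x = y
    | _, _ => False

section PendGraphAdj

variable {V : Type*} (G : SimpleGraph V) (x y : V)

@[simp] lemma pendGraph_adj_inl_inl :
    (pendGraph G).Adj (Sum.inl x) (Sum.inl y) ↔ G.Adj x y := by
  simp only [pendGraph, SimpleGraph.fromRel_adj, ne_eq, Sum.inl.injEq]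
  exact ⟨fun h => h.2.elim id SimpleGraph.Adj.symm, fun h => ⟨h.ne, Or.inl h⟩⟩

@[simp] lemma pendGraph_adj_inl_inr :
    (pendGraph G).Adj (Sum.inl x) (Sum.inr y) ↔ x = y := by
  simp [pendGraph]

@[simp] lemma pendGraph_adj_inr_inl :
    (pendGraph G).Adj (Sum.inr x) (Sum.inl y) ↔ x = y := by
  simp [pendGraph, eq_comm]

@[simp] lemma not_pendGraph_adj_inr_inr :
    ¬ (pendGraph G).Adj (Sum.inr x) (Sum.inr y) := by
  simp [pendGraph]

end PendGraphAdj

/-- The vertex set of the pendant edge at `x`. -/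
def pendantPair {V : Type*} [DecidableEq V] (x : V) : Finset (V ⊕ V) :=
  {Sum.inl x, Sum.inr x}

@[simp] lemma inl_mem_pendantPair {V : Type*} [DecidableEq V] {x y : V} :
    Sum.inl y ∈ pendantPair x ↔ y = x := by
  simp [pendantPair]

@[simp] lemma inr_mem_pendantPair {V : Type*} [DecidableEq V] {x y : V} :
    Sum.inr y ∈ pendantPair x ↔ y = x := by
  simp [pendantPair]

lemma pendantPair_injective {V : Type*} [DecidableEq V] :
    Function.Injective (pendantPair (V := V)) := fun _ _ h =>
  inl_mem_pendantPair.1 (h ▸ inl_mem_pendantPair.2 rfl)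

lemma isClique_pendantPair {V : Type*} [DecidableEq V] (G : SimpleGraph V) (x : V) :
    (pendGraph G).IsClique (pendantPair x : Set (V ⊕ V)) := by
  rintro (a | a) ha (b | b) hb hab <;>
    simp only [Finset.mem_coe, inl_mem_pendantPair, inr_mem_pendantPair] at ha hb <;>
    subst ha hb <;> simp_all

lemma eq_pendantPair_of_isClique {V : Type*} [DecidableEq V] {G : SimpleGraph V}
    {C : Finset (V ⊕ V)} (hC : (pendGraph G).IsClique (C : Set (V ⊕ V))) {x : V}
    (hl : Sum.inl x ∈ C) (hr : Sum.inr x ∈ C) : C = pendantPair x := by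
  ext (y | y)
  · rw [inl_mem_pendantPair]
    refine ⟨fun hy => ?_, fun h => h ▸ hl⟩
    simpa using hC hy hr (by simp)
  · rw [inr_mem_pendantPair]
    refine ⟨fun hy => ?_, fun h => h ▸ hr⟩
    simpa [eq_comm] using hC hl hy (by simp)

lemma graphAlpha_pendGraph {V : Type*} [Fintype V] (G : SimpleGraph V) :
    graphAlpha (pendGraph G) = Fintype.card V := by
  classical
  refine IsGreatest.csSup_eq ⟨⟨Finset.univ.map Function.Embedding.inr, ?_, by simp⟩, ?_⟩
  · rintro (a | a) ha (b | b) hb - <;> simp_all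
  · rintro n ⟨s, hs, rfl⟩
    refine Finset.card_le_card_of_injOn (Sum.elim id id) (by simp) ?_
    rintro (a | a) ha (b | b) hb hab <;>
      simp only [Sum.elim_inl, Sum.elim_inr, id_eq] at hab <;> subst hab
    · rfl
    · exact (hs ha hb (by simp) (by simp)).elim
    · exact (hs ha hb (by simp) (by simp)).elim
    · rfl

lemma exists_isEdgeCliquePartition {V : Type*} [Fintype V] [DecidableEq V]
    (G : SimpleGraph V) : ∃ 𝒞 : Finset (Finset V), IsEdgeCliquePartition G 𝒞 := by
  classical
  refine ⟨(Finset.univ.filter fun p : V × V => G.Adj p.1 p.2).image fun p => {p.1, p.2},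
    ⟨?_, fun u v h => ⟨{u, v}, Finset.mem_image.2 ⟨(u, v), by simpa using h, rfl⟩, by simp⟩⟩, ?_⟩
  · intro C hC
    obtain ⟨⟨u, v⟩, h, rfl⟩ := Finset.mem_image.1 hC
    have h : G.Adj u v := by simpa using h
    simpa [SimpleGraph.isClique_pair] using fun _ => h
  · intro C₁ h₁ C₂ h₂ hne
    have card_eq_two {C : Finset V}
        (hC : C ∈ (Finset.univ.filter fun p : V × V => G.Adj p.1 p.2).image
          fun p => {p.1, p.2}) : C.card = 2 := by
      obtain ⟨⟨u, v⟩, h, rfl⟩ := Finset.mem_image.1 hC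
      have h : G.Adj u v := by simpa using h
      exact Finset.card_pair h.ne
    have c₁ := card_eq_two h₁
    have c₂ := card_eq_two h₂
    by_contra! hlt
    refine hne ((Finset.eq_of_subset_of_card_le Finset.inter_subset_left ?_).symm.trans
      (Finset.eq_of_subset_of_card_le Finset.inter_subset_right ?_)) <;> omega

lemma exists_isEdgeCliquePartition_card_eq_ecpNum {V : Type*} [Fintype V] [DecidableEq V]
    (G : SimpleGraph V) :
    ∃ 𝒞 : Finset (Finset V), IsEdgeCliquePartition G 𝒞 ∧ 𝒞.card = ecpNum G := by
  obtain ⟨𝒞, h⟩ := exists_isEdgeCliquePartition G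
  exact Nat.sInf_mem (s := {n | ∃ 𝒞 : Finset (Finset V), IsEdgeCliquePartition G 𝒞 ∧ 𝒞.card = n})
    ⟨_, 𝒞, h, rfl⟩

lemma IsEdgeCliquePartition.ecpNum_le {V : Type*} [Fintype V] [DecidableEq V]
    {G : SimpleGraph V} {𝒞 : Finset (Finset V)} (h : IsEdgeCliquePartition G 𝒞) :
    ecpNum G ≤ 𝒞.card :=
  Nat.sInf_le ⟨𝒞, h, rfl⟩

lemma IsEdgeCliquePartition.image_pendantPair_union {V : Type*} [Fintype V] [DecidableEq V]
    {G : SimpleGraph V} {𝒞 : Finset (Finset V)} (h : IsEdgeCliquePartition G 𝒞) :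
    IsEdgeCliquePartition (pendGraph G)
      (Finset.univ.image pendantPair ∪ 𝒞.image (Finset.map Function.Embedding.inl)) := by
  obtain ⟨⟨hcl, hcov⟩, hint⟩ := h
  refine ⟨⟨?_, ?_⟩, ?_⟩
  · intro C hC
    simp only [Finset.mem_union, Finset.mem_image, Finset.mem_univ, true_and] at hC
    obtain ⟨x, rfl⟩ | ⟨D, hD, rfl⟩ := hC
    · exact isClique_pendantPair G x
    · rintro (a | a) ha (b | b) hb hab <;> simp at ha hb
      simpa using hcl D hD ha hb (by simpa using hab)
  · rintro (u | u) (v | v) huv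
    · obtain ⟨C, hC, hu, hv⟩ := hcov u v (by simpa using huv)
      exact ⟨C.map Function.Embedding.inl,
        Finset.mem_union_right _ (Finset.mem_image_of_mem _ hC), by simpa, by simpa⟩
    · exact ⟨pendantPair u, by simp, by simp, by simpa [eq_comm] using huv⟩
    · exact ⟨pendantPair u, by simp, by simp, by simpa [eq_comm] using huv⟩
    · simp at huv
  · intro C₁ h₁ C₂ h₂ hne
    simp only [Finset.mem_union, Finset.mem_image, Finset.mem_univ, true_and] at h₁ h₂
    obtain ⟨x, rfl⟩ | ⟨D₁, hD₁, rfl⟩ := h₁ <;> obtain ⟨y, rfl⟩ | ⟨D₂, hD₂, rfl⟩ := h₂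
    · have hxy : x ≠ y := fun h => hne (h ▸ rfl)
      rw [Finset.card_le_one]
      rintro (a | a) ha <;> simp at ha <;> exact (hxy (ha.1.symm.trans ha.2)).elim
    · rw [Finset.card_le_one]
      rintro (a | a) ha (b | b) hb <;> simp at ha hb
      rw [ha.1, hb.1]
    · rw [Finset.card_le_one]
      rintro (a | a) ha (b | b) hb <;> simp at ha hb
      rw [ha.2, hb.2]
    · rw [← Finset.map_inter, Finset.card_map]
      exact hint D₁ hD₁ D₂ hD₂ fun h => hne (h ▸ rfl)

lemma IsEdgeCliquePartition.image_pendantPair_subset {V : Type*} [Fintype V] [DecidableEq V]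
    {G : SimpleGraph V} {𝒟 : Finset (Finset (V ⊕ V))}
    (h : IsEdgeCliquePartition (pendGraph G) 𝒟) :
    Finset.univ.image pendantPair ⊆ 𝒟 := by
  rintro _ hP
  obtain ⟨x, -, rfl⟩ := Finset.mem_image.1 hP
  obtain ⟨C, hC, hl, hr⟩ := h.1.2 (Sum.inl x) (Sum.inr x) (by simp)
  exact eq_pendantPair_of_isClique (h.1.1 C hC) hl hr ▸ hC

lemma IsEdgeCliquePartition.image_toLeft {V : Type*} [Fintype V] [DecidableEq V]
    {G : SimpleGraph V} {𝒟 : Finset (Finset (V ⊕ V))}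
    (h : IsEdgeCliquePartition (pendGraph G) 𝒟) :
    IsEdgeCliquePartition G
      ((𝒟 \ Finset.univ.image pendantPair).image Finset.toLeft) := by
  obtain ⟨⟨hcl, hcov⟩, hint⟩ := h
  refine ⟨⟨?_, ?_⟩, ?_⟩
  · intro C hC
    obtain ⟨D, hD, rfl⟩ := Finset.mem_image.1 hC
    intro a ha b hb hab
    simpa using hcl D (Finset.mem_sdiff.1 hD).1 (Finset.mem_toLeft.1 ha)
      (Finset.mem_toLeft.1 hb) (by simpa using hab)
  · intro u v huv
    obtain ⟨C, hC, hu, hv⟩ := hcov (Sum.inl u) (Sum.inl v) (by simpa using huv)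
    refine ⟨C.toLeft, Finset.mem_image_of_mem _ (Finset.mem_sdiff.2 ⟨hC, fun hP => ?_⟩),
      by simpa, by simpa⟩
    obtain ⟨x, -, rfl⟩ := Finset.mem_image.1 hP
    simp only [inl_mem_pendantPair] at hu hv
    exact huv.ne (hu.trans hv.symm)
  · intro C₁ h₁ C₂ h₂ hne
    obtain ⟨D₁, hD₁, rfl⟩ := Finset.mem_image.1 h₁
    obtain ⟨D₂, hD₂, rfl⟩ := Finset.mem_image.1 h₂
    refine le_trans ?_ (hint D₁ (Finset.mem_sdiff.1 hD₁).1 D₂ (Finset.mem_sdiff.1 hD₂).1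
      fun h => hne (h ▸ rfl))
    exact Finset.card_le_card_of_injOn Sum.inl (by intro a; simp) Sum.inl_injective.injOn

lemma ecpNum_pendGraph {V : Type*} [Fintype V] [DecidableEq V] (G : SimpleGraph V) :
    ecpNum (pendGraph G) = Fintype.card V + ecpNum G := by
  have hcard : (Finset.univ.image (pendantPair (V := V))).card = Fintype.card V :=
    Finset.card_image_of_injective _ pendantPair_injective
  apply le_antisymm
  · obtain ⟨𝒞, h, hn⟩ := exists_isEdgeCliquePartition_card_eq_ecpNum G
    rw [← hn, ← hcard]
    exact h.image_pendantPair_union.ecpNum_le.trans ((Finset.card_union_le _ _).trans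
      (Nat.add_le_add_left Finset.card_image_le _))
  · obtain ⟨𝒟, h, hn⟩ := exists_isEdgeCliquePartition_card_eq_ecpNum (pendGraph G)
    rw [← hn, ← hcard, ← Finset.card_sdiff_add_card_eq_card h.image_pendantPair_subset, add_comm]
    exact Nat.add_le_add_right (h.image_toLeft.ecpNum_le.trans Finset.card_image_le) _

/-- With `G'` obtained from `G` by adding a pendant neighbor to every vertex,
`α(G') = |V(G)|` and `ecp(G') = α(G') + ecp(G)`. -/
theorem pendGraph_alpha_and_ecp {V : Type*} [Fintype V] [DecidableEq V] (G : SimpleGraph V) :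
    graphAlpha (pendGraph G) = Fintype.card V ∧
      ecpNum (pendGraph G) = graphAlpha (pendGraph G) + ecpNum G := by
  rw [ecpNum_pendGraph, graphAlpha_pendGraph]
  exact ⟨rfl, rfl⟩
end

section
/- Let G be a finite simple graph without isolated vertices, let k ≥ 0 be an integer, and let C be an edge clique cover of G with at most α(G) + k cliques. Then every maximum independent set of G contains at most k vertices that are not simplicial. -/
/-- A vertex is simplicial if its closed neighborhood `N[v] = {v} ∪ N(v)` is a clique. -/
def IsSimplicialVtx {V : Type*} (G : SimpleGraph V) (v : V) : Prop :=
  G.IsClique (insert v (G.neighborSet v))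

theorem IsSimplicialVtx.of_forall_adj_mem {V : Type*} {G : SimpleGraph V} {v : V} {C : Finset V}
    (hC : G.IsClique (C : Set V)) (hv : v ∈ C) (h : ∀ u, G.Adj v u → u ∈ C) :
    IsSimplicialVtx G v := by
  refine hC.subset ?_
  rintro x (rfl | hx)
  · exact hv
  · exact h x hx

/-- A clique meets an independent set in at most one vertex. -/
theorem IsIndepFinset.card_filter_mem_le_one {V : Type*} [DecidableEq V] {G : SimpleGraph V}
    {I C : Finset V} (hI : IsIndepFinset G I) (hC : G.IsClique (C : Set V)) :
    (I.filter fun v => v ∈ C).card ≤ 1 := by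
  refine Finset.card_le_one.2 fun a ha b hb => ?_
  rw [Finset.mem_filter] at ha hb
  by_contra hab
  exact hI ha.1 hb.1 hab (hC ha.2 hb.2 hab)

theorem IsEdgeCliqueCover.one_le_card_filter {V : Type*} [Fintype V] [DecidableEq V]
    {G : SimpleGraph V} {𝒞 : Finset (Finset V)} (hcov : IsEdgeCliqueCover G 𝒞) {v u : V}
    (hvu : G.Adj v u) : 1 ≤ (𝒞.filter fun C => v ∈ C).card := by
  obtain ⟨C, hC, hv, -⟩ := hcov.2 v u hvu
  exact Finset.card_pos.2 ⟨C, Finset.mem_filter.2 ⟨hC, hv⟩⟩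

/-- A non-isolated vertex lying in at most one clique of an edge clique cover is simplicial. -/
theorem IsEdgeCliqueCover.isSimplicialVtx {V : Type*} [Fintype V] [DecidableEq V]
    {G : SimpleGraph V} {𝒞 : Finset (Finset V)} (hcov : IsEdgeCliqueCover G 𝒞) {v u : V}
    (hvu : G.Adj v u) (hle : (𝒞.filter fun C => v ∈ C).card ≤ 1) : IsSimplicialVtx G v := by
  obtain ⟨C, hC, hv, -⟩ := hcov.2 v u hvu
  refine .of_forall_adj_mem (hcov.1 C hC) hv fun w hw => ?_
  obtain ⟨D, hD, hvD, hwD⟩ := hcov.2 v w hw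
  have hDC : D = C := Finset.card_le_one.1 hle D (Finset.mem_filter.2 ⟨hD, hvD⟩) C
    (Finset.mem_filter.2 ⟨hC, hv⟩)
  exact hDC ▸ hwD

open scoped Classical in
/-- If `G` has no isolated vertices and `𝒞` is an edge clique cover of `G`
with at most `α(G) + k` cliques, then every maximum independent set of `G` contains at
most `k` non-simplicial vertices. -/
theorem nonsimplicial_vertices_le {V : Type*} [Fintype V] [DecidableEq V]
    (G : SimpleGraph V) (k : ℕ)
    (hiso : ∀ v : V, ∃ u, G.Adj v u)
    (𝒞 : Finset (Finset V)) (hcov : IsEdgeCliqueCover G 𝒞)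
    (hcard : 𝒞.card ≤ graphAlpha G + k) :
    ∀ I : Finset V, IsIndepFinset G I → I.card = graphAlpha G →
      (I.filter fun v => ¬ IsSimplicialVtx G v).card ≤ k := by
  intro I hI hIcard
  have hlower : ∑ v ∈ I, (1 + if ¬ IsSimplicialVtx G v then 1 else 0) ≤
      ∑ v ∈ I, (𝒞.filter fun C => v ∈ C).card := by
    refine Finset.sum_le_sum fun v _ => ?_
    obtain ⟨u, hu⟩ := hiso v
    have hpos := hcov.one_le_card_filter hu
    split_ifs with hs
    · exact hpos
    · by_contra hlt
      exact hs (hcov.isSimplicialVtx hu (by omega))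
  have hdouble : ∑ v ∈ I, (𝒞.filter fun C => v ∈ C).card =
      ∑ C ∈ 𝒞, (I.filter fun v => v ∈ C).card :=
    Finset.sum_card_bipartiteAbove_eq_sum_card_bipartiteBelow fun v C => v ∈ C
  have hupper : ∑ C ∈ 𝒞, (I.filter fun v => v ∈ C).card ≤ 𝒞.card := by
    simpa using Finset.sum_le_card_nsmul 𝒞 _ 1
      fun C hC => hI.card_filter_mem_le_one (hcov.1 C hC)
  rw [Finset.sum_add_distrib, ← Finset.card_filter, ← Finset.card_eq_sum_ones] at hlower
  omega
end

section
/- Let G be a finite simple graph without isolated vertices, let k ≥ 0 be an integer, and let C be an edge clique cover of G with at most α(G) + k cliques. Then the number of cliques of C that are not simplicial cliques of G is at most 2k. -/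
/-- A clique (given here as a finset of vertices) is a simplicial clique of `G` if it is
the closed neighborhood `N[v]` of some simplicial vertex `v`. -/
def IsSimplicialClique {V : Type*} (G : SimpleGraph V) (C : Finset V) : Prop :=
  ∃ v : V, IsSimplicialVtx G v ∧ (C : Set V) = insert v (G.neighborSet v)

lemma exists_isIndepFinset_card_eq_graphAlpha {V : Type*} [Fintype V] (G : SimpleGraph V) :
    ∃ s : Finset V, IsIndepFinset G s ∧ s.card = graphAlpha G := by
  refine Nat.sSup_mem (s := {n | ∃ s : Finset V, IsIndepFinset G s ∧ s.card = n})
    ⟨0, ∅, by simp [IsIndepFinset], rfl⟩ ⟨Fintype.card V, ?_⟩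
  rintro _ ⟨s, -, rfl⟩
  exact s.card_le_univ

/-- Distinct vertices of an independent set lie in distinct cliques. -/
lemma IsIndepFinset.sum_card_filter_mem_le {V : Type*} [DecidableEq V] {G : SimpleGraph V}
    {s : Finset V} (hs : IsIndepFinset G s) {𝒞 : Finset (Finset V)}
    (h𝒞 : ∀ C ∈ 𝒞, G.IsClique (C : Set V)) :
    ∑ v ∈ s, (𝒞.filter fun C => v ∈ C).card ≤ 𝒞.card := by
  rw [← Finset.card_biUnion]
  · exact Finset.card_le_card (Finset.biUnion_subset.2 fun v _ => Finset.filter_subset _ _)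
  · intro u hu v hv huv
    refine Finset.disjoint_left.2 fun C hC hC' => ?_
    rw [Finset.mem_filter] at hC hC'
    exact hs hu hv huv (h𝒞 C hC.1 hC.2 hC'.2 huv)

/-- If a non-isolated vertex lies in a single clique of an edge clique cover, then that clique
is its closed neighborhood. -/
lemma IsEdgeCliqueCover.isSimplicialClique_of_unique {V : Type*} {G : SimpleGraph V}
    {𝒞 : Finset (Finset V)} (hcov : IsEdgeCliqueCover G 𝒞) {v : V} {C : Finset V}
    (hC : C ∈ 𝒞) (hv : v ∈ C) (huniq : ∀ D ∈ 𝒞, v ∈ D → D = C) :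
    IsSimplicialClique G C := by
  have heq : (C : Set V) = insert v (G.neighborSet v) := by
    ext u
    simp only [Finset.mem_coe, Set.mem_insert_iff, SimpleGraph.mem_neighborSet]
    constructor
    · intro hu
      by_cases huv : u = v
      · exact .inl huv
      · exact .inr (hcov.1 C hC hv hu (Ne.symm huv))
    · rintro (rfl | hadj)
      · exact hv
      · obtain ⟨D, hD, hvD, huD⟩ := hcov.2 v u hadj
        exact huniq D hD hvD ▸ huD
  exact ⟨v, by rw [IsSimplicialVtx, ← heq]; exact hcov.1 C hC, heq⟩

open scoped Classical in
/-- A non-isolated vertex lies in a simplicial clique of an edge clique cover or in at least two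
other cliques of it. -/
lemma IsEdgeCliqueCover.two_le_card_filter {V : Type*} [DecidableEq V] {G : SimpleGraph V}
    {𝒞 : Finset (Finset V)} (hcov : IsEdgeCliqueCover G 𝒞) {v : V} (hv : ∃ u, G.Adj v u) :
    2 ≤ 2 * ((𝒞.filter fun C => IsSimplicialClique G C).filter fun C => v ∈ C).card +
      ((𝒞.filter fun C => ¬ IsSimplicialClique G C).filter fun C => v ∈ C).card := by
  obtain ⟨u, hu⟩ := hv
  obtain ⟨C, hC, hvC, -⟩ := hcov.2 v u hu
  by_cases h : ∃ D ∈ 𝒞, IsSimplicialClique G D ∧ v ∈ D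
  · obtain ⟨D, hD, hDs, hvD⟩ := h
    have : 0 < ((𝒞.filter fun C => IsSimplicialClique G C).filter fun C => v ∈ C).card :=
      Finset.card_pos.2 ⟨D, by simp [hD, hDs, hvD]⟩
    omega
  · push Not at h
    obtain ⟨D, hD, hvD, hne⟩ : ∃ D ∈ 𝒞, v ∈ D ∧ D ≠ C := by
      by_contra! huniq
      exact h C hC (hcov.isSimplicialClique_of_unique hC hvC huniq) hvC
    have : 1 < ((𝒞.filter fun C => ¬ IsSimplicialClique G C).filter fun C => v ∈ C).card := by
      refine Finset.one_lt_card.2 ⟨D, ?_, C, ?_, hne⟩ <;> simp only [Finset.mem_filter]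
      · exact ⟨⟨hD, fun hs => h D hD hs hvD⟩, hvD⟩
      · exact ⟨⟨hC, fun hs => h C hC hs hvC⟩, hvC⟩
    omega


open scoped Classical in
/-- If `G` has no isolated vertices and `𝒞` is an edge clique cover of `G`
with at most `α(G) + k` cliques, then at most `2k` cliques of `𝒞` are not simplicial
cliques of `G`. -/
theorem nonsimplicial_cliques_le {V : Type*} [Fintype V] [DecidableEq V]
    (G : SimpleGraph V) (k : ℕ)
    (hiso : ∀ v : V, ∃ u, G.Adj v u)
    (𝒞 : Finset (Finset V)) (hcov : IsEdgeCliqueCover G 𝒞)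
    (hcard : 𝒞.card ≤ graphAlpha G + k) :
    (𝒞.filter fun C => ¬ IsSimplicialClique G C).card ≤ 2 * k := by
  obtain ⟨s, hs, hsα⟩ := exists_isIndepFinset_card_eq_graphAlpha G
  have hlower := Finset.sum_le_sum fun v (_ : v ∈ s) => hcov.two_le_card_filter (hiso v)
  rw [Finset.sum_const, Finset.sum_add_distrib, ← Finset.mul_sum, smul_eq_mul] at hlower
  have hsimp := hs.sum_card_filter_mem_le (𝒞 := 𝒞.filter fun C => IsSimplicialClique G C)
    fun C hC => hcov.1 C (Finset.mem_filter.1 hC).1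
  have hnonsimp := hs.sum_card_filter_mem_le (𝒞 := 𝒞.filter fun C => ¬ IsSimplicialClique G C)
    fun C hC => hcov.1 C (Finset.mem_filter.1 hC).1
  have htotal := Finset.card_filter_add_card_filter_not (s := 𝒞) fun C => IsSimplicialClique G C
  omega
end

section
/- For every integer n ≥ 3, every edge clique partition of the complete graph K_n in which each clique has at most n − 1 vertices consists of at least n cliques. -/
/-- de Bruijn–Erdős: For `n ≥ 3`, every edge clique partition of the
complete graph `K_n` in which each clique has at most `n - 1` vertices consists of at
least `n` cliques. -/
theorem deBruijn_Erdos (n : ℕ) (hn : 3 ≤ n) (𝒞 : Finset (Finset (Fin n)))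
    (hpart : IsEdgeCliquePartition (⊤ : SimpleGraph (Fin n)) 𝒞)
    (hsize : ∀ C ∈ 𝒞, C.card ≤ n - 1) :
    n ≤ 𝒞.card := by
  obtain ⟨⟨-, hcover⟩, hinter⟩ := hpart
  replace hcover : ∀ {u v : Fin n}, u ≠ v → ∃ C ∈ 𝒞, u ∈ C ∧ v ∈ C := fun {u v} h =>
    hcover u v h
  have hmiss : ∀ C ∈ 𝒞, ∃ v, v ∉ C := by
    intro C hC
    by_contra! h
    have hcard := hsize C hC
    rw [Finset.eq_univ_of_forall h, Finset.card_fin] at hcard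
    omega
  have hunique : ∀ {u v : Fin n} {C D : Finset (Fin n)}, C ∈ 𝒞 → D ∈ 𝒞 →
      u ∈ C → v ∈ C → u ∈ D → v ∈ D → u = v ∨ C = D := by
    intro u v C D hC hD huC hvC huD hvD
    refine or_iff_not_imp_right.mpr fun hne => ?_
    exact Finset.card_le_one.mp (hinter C hC D hD hne) u (Finset.mem_inter.mpr ⟨huC, huD⟩) v
      (Finset.mem_inter.mpr ⟨hvC, hvD⟩)
  have hline : ∀ p : Fin n, ∃ C ∈ 𝒞, p ∉ C := by
    intro p
    have : Nontrivial (Fin n) := Fin.nontrivial_iff_two_le.mpr (by omega)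
    obtain ⟨q, hqp⟩ := exists_ne p
    obtain ⟨C, hC, hqC, hpC⟩ := hcover hqp
    obtain ⟨r, hrC⟩ := hmiss C hC
    obtain ⟨D, hD, hqD, hrD⟩ := hcover (ne_of_mem_of_not_mem hqC hrC)
    refine ⟨D, hD, fun hpD => ?_⟩
    rcases hunique hC hD hqC hpC hqD hpD with h | rfl
    · exact hqp h
    · exact hrC hrD
  let incidence : Membership (Fin n) {C // C ∈ 𝒞} := ⟨fun C v => v ∈ C.1⟩
  choose line hline_mem hleft hright using @hcover
  let config : Configuration.HasLines (Fin n) {C // C ∈ 𝒞} :=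
    { exists_point := fun C => hmiss C.1 C.2
      exists_line := fun p => (hline p).elim fun C h => ⟨⟨C, h.1⟩, h.2⟩
      eq_or_eq := fun {_ _ C D} h₁ h₂ h₃ h₄ =>
        (hunique C.2 D.2 h₁ h₂ h₃ h₄).imp_right Subtype.ext
      mkLine := fun h => ⟨line h, hline_mem h⟩
      mkLine_ax := fun h => ⟨hleft h, hright h⟩ }
  simpa using Configuration.HasLines.card_le (Fin n) {C // C ∈ 𝒞}
end

section
/- Let G be a finite simple graph without isolated vertices. Let S be the set of simplicial vertices of G, let 𝒮 = {N[v] : v is a simplicial vertex of G} be the set of distinct simplicial cliques of G, and let B be the set of edges of G that are not contained in any simplicial clique of G (note that every edge in B has both endpoints in V(G) ∖ S). Then ecc(G) = m + |𝒮|, where m is the minimum number of cliques of the induced subgraph G − S such that every edge of B has both endpoints in at least one of them (with m = 0 when B = ∅). -/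
/-- The minimum number of cliques in an edge clique cover of `G`. -/
noncomputable def eccNum {V : Type*} [Fintype V] (G : SimpleGraph V) : ℕ :=
  sInf {n | ∃ 𝒞 : Finset (Finset V), IsEdgeCliqueCover G 𝒞 ∧ 𝒞.card = n}

open scoped Classical in
/-- The set `𝒮 = {N[v] : v a simplicial vertex of G}` of distinct simplicial cliques. -/
noncomputable def simplicialCliques {V : Type*} [Fintype V] (G : SimpleGraph V) :
    Finset (Finset V) :=
  (Finset.univ.filter fun v => IsSimplicialVtx G v).image
    fun v => insert v (G.neighborFinset v)

theorem mem_simplicialCliques_iff {V : Type*} [Fintype V] (G : SimpleGraph V) (K : Finset V) :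
    K ∈ simplicialCliques G ↔
      ∃ v, IsSimplicialVtx G v ∧ ∀ x, x ∈ K ↔ x = v ∨ G.Adj v x := by
  simp [simplicialCliques, Finset.ext_iff, iff_comm]

theorem IsSimplicialVtx.adj_of_adj {V : Type*} {G : SimpleGraph V} {v x y : V}
    (hv : IsSimplicialVtx G v) (hx : x = v ∨ G.Adj v x) (hy : y = v ∨ G.Adj v y)
    (hxy : x ≠ y) : G.Adj x y :=
  hv (by simpa using hx) (by simpa using hy) hxy

theorem IsSimplicialVtx.closedNeighborhood_subset {V : Type*} {G : SimpleGraph V} {v w x : V}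
    (hv : IsSimplicialVtx G v) (hvw : w = v ∨ G.Adj v w) (hx : x = v ∨ G.Adj v x) :
    x = w ∨ G.Adj w x :=
  or_iff_not_imp_left.2 fun h => hv.adj_of_adj hvw hx (Ne.symm h)

theorem SimpleGraph.IsClique.mem_closedNeighborhood {V : Type*} {G : SimpleGraph V}
    {C : Finset V} (hC : G.IsClique (C : Set V)) {v x : V} (hv : v ∈ C) (hx : x ∈ C) :
    x = v ∨ G.Adj v x :=
  or_iff_not_imp_left.2 fun h => hC hv hx (Ne.symm h)

/-- An edge clique cover of a graph without isolated vertices has at least as many members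
meeting the simplicial vertices as there are simplicial cliques. -/
theorem IsEdgeCliqueCover.card_simplicialCliques_le {V : Type*} [Fintype V]
    {G : SimpleGraph V} (hiso : ∀ v : V, ∃ u, G.Adj v u) {𝒞 : Finset (Finset V)}
    (h𝒞 : IsEdgeCliqueCover G 𝒞) [DecidablePred fun C : Finset V => ∃ v ∈ C, IsSimplicialVtx G v] :
    (simplicialCliques G).card ≤ (𝒞.filter fun C => ∃ v ∈ C, IsSimplicialVtx G v).card := by
  refine Finset.card_le_card_of_forall_subsingleton
    (fun K C => ∃ v ∈ C, IsSimplicialVtx G v ∧ ∀ x, x ∈ K ↔ x = v ∨ G.Adj v x) ?_ ?_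
  · intro K hK
    obtain ⟨v, hv, hKv⟩ := (mem_simplicialCliques_iff G K).1 hK
    obtain ⟨u, hu⟩ := hiso v
    obtain ⟨C, hC, hvC, -⟩ := h𝒞.2 v u hu
    exact ⟨C, Finset.mem_filter.2 ⟨hC, v, hvC, hv⟩, v, hvC, hv, hKv⟩
  · rintro C hC K ⟨-, v, hvC, hv, hK⟩ L ⟨-, w, hwC, hw, hL⟩
    have hclique := h𝒞.1 C (Finset.mem_filter.1 hC).1
    ext x
    rw [hK, hL]
    exact ⟨hv.closedNeighborhood_subset (hclique.mem_closedNeighborhood hvC hwC),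
      hw.closedNeighborhood_subset (hclique.mem_closedNeighborhood hwC hvC)⟩

theorem exists_isEdgeCliqueCover {V : Type*} [Fintype V] (G : SimpleGraph V) :
    ∃ 𝒞 : Finset (Finset V), IsEdgeCliqueCover G 𝒞 := by
  classical
  refine ⟨Finset.univ.filter fun C => G.IsClique (C : Set V), by simp, fun u v huv =>
    ⟨{u, v}, ?_, by simp, by simp⟩⟩
  simpa using fun _ => huv

/-- For a graph `G` without isolated vertices, with `S` the set of simplicial
vertices, `𝒮` the set of distinct simplicial cliques and `B` the set of edges of `G` not
contained in any simplicial clique, one has `ecc(G) = m + |𝒮|`, where `m` is the minimum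
number of cliques of the induced subgraph `G - S` (equivalently, cliques of `G` all of
whose vertices are non-simplicial) such that every edge of `B` has both endpoints in at
least one of them (`m = 0` when `B = ∅`). -/
theorem ecc_eq_annotated_plus_simplicial {V : Type*} [Fintype V] [DecidableEq V]
    (G : SimpleGraph V) (hiso : ∀ v : V, ∃ u, G.Adj v u) :
    eccNum G =
      sInf {n | ∃ 𝒞 : Finset (Finset V),
          (∀ C ∈ 𝒞, G.IsClique (C : Set V) ∧ ∀ v ∈ C, ¬ IsSimplicialVtx G v) ∧
          (∀ u v, G.Adj u v →
            (∀ w, IsSimplicialVtx G w →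
              ¬ (u ∈ insert w (G.neighborSet w) ∧ v ∈ insert w (G.neighborSet w))) →
            ∃ C ∈ 𝒞, u ∈ C ∧ v ∈ C) ∧
          𝒞.card = n} +
        (simplicialCliques G).card := by
  classical
  obtain ⟨𝒞, h𝒞, hcard⟩ : eccNum G ∈ {n | ∃ 𝒞 : Finset (Finset V),
      IsEdgeCliqueCover G 𝒞 ∧ 𝒞.card = n} :=
    Nat.sInf_mem ((exists_isEdgeCliqueCover G).imp' Finset.card fun 𝒞 h => ⟨𝒞, h, rfl⟩)
  set M := {n | ∃ 𝒞 : Finset (Finset V),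
      (∀ C ∈ 𝒞, G.IsClique (C : Set V) ∧ ∀ v ∈ C, ¬ IsSimplicialVtx G v) ∧
      (∀ u v, G.Adj u v →
        (∀ w, IsSimplicialVtx G w →
          ¬ (u ∈ insert w (G.neighborSet w) ∧ v ∈ insert w (G.neighborSet w))) →
        ∃ C ∈ 𝒞, u ∈ C ∧ v ∈ C) ∧
      𝒞.card = n}
  have hmem : (𝒞.filter fun C => ¬ ∃ v ∈ C, IsSimplicialVtx G v).card ∈ M := by
    refine ⟨_, fun C hC => ?_, fun u v huv hB => ?_, rfl⟩
    · obtain ⟨hC, hns⟩ := Finset.mem_filter.1 hC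
      exact ⟨h𝒞.1 C hC, fun v hv hs => hns ⟨v, hv, hs⟩⟩
    · obtain ⟨C, hC, hu, hv⟩ := h𝒞.2 u v huv
      refine ⟨C, Finset.mem_filter.2 ⟨hC, ?_⟩, hu, hv⟩
      rintro ⟨w, hwC, hw⟩
      exact hB w hw ⟨(h𝒞.1 C hC).mem_closedNeighborhood hwC hu,
        (h𝒞.1 C hC).mem_closedNeighborhood hwC hv⟩
  apply le_antisymm
  · obtain ⟨𝒟, h𝒟, hcover, h𝒟card⟩ := Nat.sInf_mem ⟨_, hmem⟩
    rw [← h𝒟card]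
    refine le_trans (Nat.sInf_le ?_) (Finset.card_union_le 𝒟 (simplicialCliques G))
    refine ⟨𝒟 ∪ simplicialCliques G, ⟨fun C hC => ?_, fun u v huv => ?_⟩, rfl⟩
    · rcases Finset.mem_union.1 hC with hC | hC
      · exact (h𝒟 C hC).1
      · obtain ⟨w, hw, hCw⟩ := (mem_simplicialCliques_iff G C).1 hC
        exact fun x hx y hy hxy => hw.adj_of_adj ((hCw x).1 hx) ((hCw y).1 hy) hxy
    · by_cases hB : ∃ w, IsSimplicialVtx G w ∧
          u ∈ insert w (G.neighborSet w) ∧ v ∈ insert w (G.neighborSet w)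
      · obtain ⟨w, hw, hu, hv⟩ := hB
        refine ⟨insert w (G.neighborFinset w), Finset.mem_union_right _
          ((mem_simplicialCliques_iff G _).2 ⟨w, hw, by simp⟩), ?_, ?_⟩
        · simpa using hu
        · simpa using hv
      · obtain ⟨C, hC, hu, hv⟩ := hcover u v huv fun w hw h => hB ⟨w, hw, h⟩
        exact ⟨C, Finset.mem_union_left _ hC, hu, hv⟩
  · have hsplit := Finset.card_filter_add_card_filter_not (s := 𝒞)
      (fun C => ∃ v ∈ C, IsSimplicialVtx G v)
    have hsimp := h𝒞.card_simplicialCliques_le hiso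
    have hinf := Nat.sInf_le hmem
    omega
end

section
/- Let G be a finite simple graph, let B ⊆ E(G), and let k ≥ 0 be an integer. Define the graph H whose vertex set is B and in which two distinct edges e, e' ∈ B are adjacent if and only if the union of the endpoints of e and e' is not a clique of G. Then there exist at most k cliques of G such that every edge of B has both endpoints in at least one of them if and only if H admits a proper k-coloring. -/
/-- The conflict graph `H` of an instance of annotated edge clique cover: its vertices are
the edges of `B`, and two distinct edges `e, e'` are adjacent iff the union of their
endpoints is not a clique of `G`. -/
def conflictGraph {V : Type*} (G : SimpleGraph V) (B : Set (Sym2 V)) : SimpleGraph ↥B :=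
  SimpleGraph.fromRel fun e f =>
    ¬ G.IsClique ({x | x ∈ (e : Sym2 V)} ∪ {x | x ∈ (f : Sym2 V)})

theorem conflictGraph_adj {V : Type*} {G : SimpleGraph V} {B : Set (Sym2 V)} {e f : B} :
    (conflictGraph G B).Adj e f ↔ e ≠ f ∧
      ¬ G.IsClique ({x | x ∈ (e : Sym2 V)} ∪ {x | x ∈ (f : Sym2 V)}) := by
  rw [conflictGraph, SimpleGraph.fromRel_adj, Set.union_comm {x | x ∈ (f : Sym2 V)}, or_self]

theorem isClique_union_of_not_conflictGraph_adj {V : Type*} {G : SimpleGraph V}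
    {B : Set (Sym2 V)} (hB : B ⊆ G.edgeSet) {e f : B} (h : ¬ (conflictGraph G B).Adj e f) :
    G.IsClique ({x | x ∈ (e : Sym2 V)} ∪ {x | x ∈ (f : Sym2 V)}) := by
  by_cases hef : e = f
  · subst hef
    rw [Set.union_self]
    intro x hx y hy hxy
    rw [← SimpleGraph.mem_edgeSet, ← (Sym2.mem_and_mem_iff hxy).1 ⟨hx, hy⟩]
    exact hB e.2
  · by_contra hc
    exact h (conflictGraph_adj.2 ⟨hef, hc⟩)

/-- For `B ⊆ E(G)` and `k ≥ 0`, there exist at most `k` cliques of `G` such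
that every edge of `B` has both endpoints in at least one of them iff the conflict graph
`H` admits a proper `k`-coloring. -/
theorem annotated_cover_iff_colorable {V : Type*} [Fintype V] [DecidableEq V]
    (G : SimpleGraph V) (B : Set (Sym2 V)) (hB : B ⊆ G.edgeSet) (k : ℕ) :
    (∃ 𝒞 : Finset (Finset V), (∀ C ∈ 𝒞, G.IsClique (C : Set V)) ∧
        (∀ e ∈ B, ∃ C ∈ 𝒞, ∀ x ∈ e, x ∈ C) ∧ 𝒞.card ≤ k) ↔
      (conflictGraph G B).Colorable k := by
  constructor
  · rintro ⟨𝒞, hclique, hcover, hcard⟩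
    choose! C hC hmem using hcover
    let c : (conflictGraph G B).Coloring 𝒞 :=
      SimpleGraph.Coloring.mk (fun e => ⟨C e, hC e e.2⟩) fun {e f} hadj heq => by
        have hCeq : C e = C f := congrArg Subtype.val heq
        refine (conflictGraph_adj.1 hadj).2 ((hclique _ (hC e e.2)).subset ?_)
        rintro x (hx | hx)
        · exact hmem e e.2 x hx
        · rw [hCeq]
          exact hmem f f.2 x hx
    exact c.colorable.mono (by simpa using hcard)
  · rintro ⟨c⟩
    classical
    let K : Fin k → Finset V := fun i => {x | ∃ e : B, c e = i ∧ x ∈ (e : Sym2 V)}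
    refine ⟨Finset.univ.image K, ?_, ?_, ?_⟩
    · simp only [Finset.mem_image, Finset.mem_univ, true_and, forall_exists_index,
        forall_apply_eq_imp_iff]
      intro i x hx y hy hxy
      simp only [K, Finset.coe_filter, Finset.mem_univ, true_and, Set.mem_ofPred_eq] at hx hy
      obtain ⟨e, he, hxe⟩ := hx
      obtain ⟨f, hf, hyf⟩ := hy
      exact isClique_union_of_not_conflictGraph_adj hB
        (fun hadj => c.valid hadj (he.trans hf.symm)) (Or.inl hxe) (Or.inr hyf) hxy
    · intro e he
      refine ⟨K (c ⟨e, he⟩), Finset.mem_image_of_mem K (Finset.mem_univ _), fun x hx => ?_⟩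
      simp only [K, Finset.mem_filter, Finset.mem_univ, true_and]
      exact ⟨⟨e, he⟩, rfl, hx⟩
    · exact Finset.card_image_le.trans (by simp)
end

section
/- Let G be a finite simple graph with vertex set {v_1, …, v_n} and let k ≥ 0 be an integer. Define the graph G' with vertex set V(G) × {1, 2}, in which two distinct vertices (v_i, a) and (v_j, b) are adjacent if and only if a = b, or a ≠ b and (i = j or v_i v_j ∈ E(G)). Let B = {(v_i, 1)(v_i, 2) : 1 ≤ i ≤ n}. Then there exist at most k cliques of G such that every vertex of G belongs to at least one of them if and only if there exist at most k cliques of G' such that every edge of B has both endpoints in at least one of them. -/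
/-- The co-bipartite graph `G'` on `V × Bool` (two copies of `V(G)`, copy `1` indexed by
`false` and copy `2` by `true`): two distinct vertices `(v_i, a)` and `(v_j, b)` are
adjacent iff `a = b`, or `a ≠ b` and (`i = j` or `v_i v_j ∈ E(G)`). -/
def doubledGraph {V : Type*} (G : SimpleGraph V) : SimpleGraph (V × Bool) :=
  SimpleGraph.fromRel fun p q => p.2 = q.2 ∨ p.1 = q.1 ∨ G.Adj p.1 q.1

theorem doubledGraph_adj {V : Type*} (G : SimpleGraph V) (p q : V × Bool) :
    (doubledGraph G).Adj p q ↔ p ≠ q ∧ (p.2 = q.2 ∨ p.1 = q.1 ∨ G.Adj p.1 q.1) := by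
  simp only [doubledGraph, SimpleGraph.fromRel_adj, G.adj_comm q.1, eq_comm (a := q.1),
    eq_comm (a := q.2), or_self]

/-- The preimage of a clique of `G` under the projection is a clique of the doubled graph. -/
theorem SimpleGraph.IsClique.doubledGraph_preimage_fst {V : Type*} {G : SimpleGraph V}
    {s : Set V} (hs : G.IsClique s) : (doubledGraph G).IsClique (Prod.fst ⁻¹' s) := by
  intro p hp q hq hpq
  refine (doubledGraph_adj G p q).2 ⟨hpq, Or.inr ?_⟩
  exact (eq_or_ne p.1 q.1).imp_right (hs hp hq)

/-- The vertices both of whose copies lie in a given clique of the doubled graph form a clique. -/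
theorem SimpleGraph.IsClique.of_doubledGraph {V : Type*} {G : SimpleGraph V}
    {s : Set (V × Bool)} (hs : (doubledGraph G).IsClique s) :
    G.IsClique {x | (x, false) ∈ s ∧ (x, true) ∈ s} := by
  intro x hx y hy hxy
  have h := (doubledGraph_adj G _ _).1 (hs hx.1 hy.2 (by simp))
  simpa [hxy] using h

/-- There exist at most `k` cliques of `G` covering all vertices of `G` iff
there exist at most `k` cliques of `G'` covering all edges `(v_i,1)(v_i,2)`. -/
theorem vertex_cover_iff_doubled_cover {V : Type*} [Fintype V] [DecidableEq V]
    (G : SimpleGraph V) (k : ℕ) :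
    (∃ 𝒞 : Finset (Finset V), (∀ C ∈ 𝒞, G.IsClique (C : Set V)) ∧
        (∀ x : V, ∃ C ∈ 𝒞, x ∈ C) ∧ 𝒞.card ≤ k) ↔
      (∃ 𝒞 : Finset (Finset (V × Bool)),
        (∀ C ∈ 𝒞, (doubledGraph G).IsClique (C : Set (V × Bool))) ∧
        (∀ x : V, ∃ C ∈ 𝒞, (x, false) ∈ C ∧ (x, true) ∈ C) ∧ 𝒞.card ≤ k) := by
  constructor
  · rintro ⟨𝒞, hclique, hcover, hcard⟩
    refine ⟨𝒞.image (· ×ˢ Finset.univ), ?_, fun x ↦ ?_, Finset.card_image_le.trans hcard⟩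
    · simp only [Finset.forall_mem_image]
      intro C hC
      simpa only [Finset.coe_product, Finset.coe_univ, Set.prod_univ]
        using (hclique C hC).doubledGraph_preimage_fst
    · obtain ⟨C, hC, hx⟩ := hcover x
      exact ⟨_, Finset.mem_image_of_mem _ hC, by simp [hx]⟩
  · rintro ⟨𝒞, hclique, hcover, hcard⟩
    refine ⟨𝒞.image fun C ↦ Finset.univ.filter fun x ↦ (x, false) ∈ C ∧ (x, true) ∈ C, ?_,
      fun x ↦ ?_, Finset.card_image_le.trans hcard⟩
    · simp only [Finset.forall_mem_image]
      intro C hC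
      simpa using (hclique C hC).of_doubledGraph
    · obtain ⟨C, hC, hx⟩ := hcover x
      exact ⟨_, Finset.mem_image_of_mem _ hC, by simpa using hx⟩
end

section
/- Let G be a finite simple graph, let B ⊆ E(G), and let R = E(G) ∖ B. Let G' be the graph obtained from G by adding a new vertex v adjacent to every vertex of G; adding, for each x ∈ V(G), a new vertex u_x adjacent only to x; and adding, for each edge e = xy ∈ R, a new vertex w_e adjacent exactly to x and y. Then the set I = {v} ∪ {u_x : x ∈ V(G)} ∪ {w_e : e ∈ R} is a maximum independent set of G', and hence α(G') = |V(G)| + |R| + 1. -/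
/-- The graph `G'` obtained from `G` (vertices `Sum.inl x`) by adding: a universal vertex
`v` adjacent to every vertex of `G` (the vertex `Sum.inr (Sum.inl ())`); for each
`x ∈ V(G)` a pendant vertex `u_x` adjacent only to `x` (vertices `Sum.inr (Sum.inr
(Sum.inl x))`); and for each edge `e = xy ∈ R = E(G) ∖ B`, a vertex `w_e` adjacent
exactly to `x` and `y` (vertices `Sum.inr (Sum.inr (Sum.inr e))`). -/
def hardnessGraph {V : Type*} [Fintype V] [DecidableEq V] (G : SimpleGraph V)
    [DecidableRel G.Adj] (B : Finset (Sym2 V)) :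
    SimpleGraph (V ⊕ (Unit ⊕ (V ⊕ {e // e ∈ G.edgeFinset \ B}))) :=
  SimpleGraph.fromRel fun a b =>
    match a, b with
    | Sum.inl x, Sum.inl y => G.Adj x y
    | Sum.inr (Sum.inl _), Sum.inl _ => True
    | Sum.inr (Sum.inr (Sum.inl x)), Sum.inl y => x = y
    | Sum.inr (Sum.inr (Sum.inr e)), Sum.inl y => y ∈ (e : Sym2 V)
    | _, _ => False

theorem hardnessGraph_not_adj_inr {V : Type*} [Fintype V] [DecidableEq V]
    (G : SimpleGraph V) [DecidableRel G.Adj] (B : Finset (Sym2 V))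
    (a b : Unit ⊕ (V ⊕ {e // e ∈ G.edgeFinset \ B})) :
    ¬ (hardnessGraph G B).Adj (Sum.inr a) (Sum.inr b) := by
  rcases a with _ | _ | _ <;> rcases b with _ | _ | _ <;> simp [hardnessGraph]

theorem hardnessGraph_adj_pendant {V : Type*} [Fintype V] [DecidableEq V]
    (G : SimpleGraph V) [DecidableRel G.Adj] (B : Finset (Sym2 V)) (x : V) :
    (hardnessGraph G B).Adj (Sum.inl x) (Sum.inr (Sum.inr (Sum.inl x))) := by
  simp [hardnessGraph]

/-- Replacing each original vertex by its pendant neighbour is injective on an independent set. -/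
theorem IsIndepFinset.card_le_hardnessGraph {V : Type*} [Fintype V] [DecidableEq V]
    {G : SimpleGraph V} [DecidableRel G.Adj] {B : Finset (Sym2 V)}
    {J : Finset (V ⊕ (Unit ⊕ (V ⊕ {e // e ∈ G.edgeFinset \ B})))}
    (hJ : IsIndepFinset (hardnessGraph G B) J) :
    J.card ≤ Fintype.card (Unit ⊕ (V ⊕ {e // e ∈ G.edgeFinset \ B})) := by
  refine Finset.card_le_card_of_injOn (Sum.elim (fun x => Sum.inr (Sum.inl x)) id)
    (t := Finset.univ) (fun _ _ => Finset.mem_coe.2 (Finset.mem_univ _)) ?_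
  rintro (x | a) ha (y | b) hb h
  · simpa using h
  · obtain rfl : Sum.inr (Sum.inl x) = b := h
    exact absurd (hardnessGraph_adj_pendant G B x) (hJ ha hb Sum.inl_ne_inr)
  · obtain rfl : a = Sum.inr (Sum.inl y) := h
    exact absurd (hardnessGraph_adj_pendant G B y) (hJ hb ha Sum.inl_ne_inr)
  · exact congrArg Sum.inr h

/-- The set `I = {v} ∪ {u_x : x ∈ V(G)} ∪ {w_e : e ∈ R}` (i.e. all the newly
added vertices) is a maximum independent set of `G'`, hence `α(G') = |V(G)| + |R| + 1`. -/
theorem hardnessGraph_max_indep {V : Type*} [Fintype V] [DecidableEq V]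
    (G : SimpleGraph V) [DecidableRel G.Adj] (B : Finset (Sym2 V))
    (hB : B ⊆ G.edgeFinset) :
    IsIndepFinset (hardnessGraph G B)
        (Finset.univ.map ⟨Sum.inr, Sum.inr_injective⟩) ∧
      (∀ J : Finset (V ⊕ (Unit ⊕ (V ⊕ {e // e ∈ G.edgeFinset \ B}))),
        IsIndepFinset (hardnessGraph G B) J →
          J.card ≤ (Finset.univ.map
            (⟨Sum.inr, Sum.inr_injective⟩ :
              (Unit ⊕ (V ⊕ {e // e ∈ G.edgeFinset \ B})) ↪
                (V ⊕ (Unit ⊕ (V ⊕ {e // e ∈ G.edgeFinset \ B}))))).card) ∧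
      graphAlpha (hardnessGraph G B) =
        Fintype.card V + (G.edgeFinset \ B).card + 1 := by
  have hI : IsIndepFinset (hardnessGraph G B)
      (Finset.univ.map ⟨Sum.inr, Sum.inr_injective⟩) := by
    intro a ha b hb _
    obtain ⟨a, -, rfl⟩ := Finset.mem_map.1 (Finset.mem_coe.1 ha)
    obtain ⟨b, -, rfl⟩ := Finset.mem_map.1 (Finset.mem_coe.1 hb)
    exact hardnessGraph_not_adj_inr G B a b
  have hcard : Fintype.card (Unit ⊕ (V ⊕ {e // e ∈ G.edgeFinset \ B})) =
      Fintype.card V + (G.edgeFinset \ B).card + 1 := by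
    rw [Fintype.card_sum, Fintype.card_sum, Fintype.card_coe, Fintype.card_unit, add_comm]
  refine ⟨hI, fun J hJ => ?_, ?_⟩
  · rw [Finset.card_map, Finset.card_univ]
    exact hJ.card_le_hardnessGraph
  · refine IsGreatest.csSup_eq ⟨⟨_, hI, ?_⟩, ?_⟩
    · rw [Finset.card_map, Finset.card_univ, hcard]
    · rintro _ ⟨J, hJ, rfl⟩
      exact hJ.card_le_hardnessGraph.trans_eq hcard
end

section
/- Let G be a finite simple graph, let B ⊆ E(G) be such that every vertex of G is incident to at least one edge of B, let R = E(G) ∖ B, and let k ≥ 1 be an integer. Let G' be the graph obtained from G by adding a new vertex v adjacent to every vertex of G; adding, for each x ∈ V(G), a new vertex u_x adjacent only to x; and adding, for each edge e = xy ∈ R, a new vertex w_e adjacent exactly to x and y. Then there exist at most k cliques of G such that every edge of B has both endpoints in at least one of them if and only if G' has an edge clique cover with at most |V(G)| + |R| + k cliques. -/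
namespace HardnessGraph

variable {V : Type*} [Fintype V] [DecidableEq V] {G : SimpleGraph V} [DecidableRel G.Adj]
  {B : Finset (Sym2 V)}

/-- The neighbours in `G` of the pendant vertex `u_x` or of the vertex `w_e`. -/
def attachment (G : SimpleGraph V) [DecidableRel G.Adj] (B : Finset (Sym2 V)) :
    V ⊕ {e // e ∈ G.edgeFinset \ B} → Finset V :=
  Sum.elim (fun x => {x}) (fun e => (e : Sym2 V).toFinset)

@[simp]
theorem adj_inl_inl {x y : V} :
    (hardnessGraph G B).Adj (Sum.inl x) (Sum.inl y) ↔ G.Adj x y := by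
  simp only [hardnessGraph, SimpleGraph.fromRel_adj, ne_eq, Sum.inl.injEq, G.adj_comm y x, or_self]
  exact and_iff_right_of_imp fun h => h.ne

@[simp]
theorem adj_universal {x : V} :
    (hardnessGraph G B).Adj (Sum.inr (Sum.inl ())) (Sum.inl x) := by
  simp [hardnessGraph]

@[simp]
theorem adj_attached {z : V ⊕ {e // e ∈ G.edgeFinset \ B}} {y : V} :
    (hardnessGraph G B).Adj (Sum.inr (Sum.inr z)) (Sum.inl y) ↔ y ∈ attachment G B z := by
  rcases z with x | e
  · simp [hardnessGraph, attachment, eq_comm (a := x)]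
  · simp [hardnessGraph, attachment]

@[simp]
theorem not_adj_inr_inr {a b : Unit ⊕ (V ⊕ {e // e ∈ G.edgeFinset \ B})} :
    ¬ (hardnessGraph G B).Adj (Sum.inr a) (Sum.inr b) := by
  rcases a with _ | _ | _ <;> rcases b with _ | _ | _ <;> simp [hardnessGraph]

theorem attachment_isClique (z : V ⊕ {e // e ∈ G.edgeFinset \ B}) :
    G.IsClique (attachment G B z : Set V) := by
  rcases z with x | ⟨e, he⟩
  · simp [attachment]
  · induction e with
    | h x y =>
      have h : G.Adj x y := by simpa using (Finset.mem_sdiff.mp he).1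
      intro a ha b hb hab
      simp only [attachment, Sum.elim_inr, Finset.mem_coe, Sym2.mem_toFinset, Sym2.mem_iff]
        at ha hb
      grind [G.adj_comm x y]

theorem attachment_nonempty (z : V ⊕ {e // e ∈ G.edgeFinset \ B}) :
    (attachment G B z).Nonempty := by
  rcases z with x | ⟨e, he⟩
  · simp [attachment]
  · exact ⟨e.out.1, by simp [attachment, Sym2.out_fst_mem]⟩

/-- No edge of `B` lies inside the neighbourhood of one of the vertices `u_x`, `w_e`. -/
theorem mk_notMem_of_mem_attachment {z : V ⊕ {e // e ∈ G.edgeFinset \ B}} {x y : V}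
    (hxy : x ≠ y) (hx : x ∈ attachment G B z) (hy : y ∈ attachment G B z) : s(x, y) ∉ B := by
  rcases z with w | ⟨e, he⟩
  · simp only [attachment, Sum.elim_inl, Finset.mem_singleton] at hx hy
    exact absurd (hx.trans hy.symm) hxy
  · simp only [attachment, Sum.elim_inr, Sym2.mem_toFinset] at hx hy
    rw [← (Sym2.mem_and_mem_iff hxy).mp ⟨hx, hy⟩]
    exact (Finset.mem_sdiff.mp he).2

/-- Adding to a clique of `G` a new vertex adjacent to all of it gives a clique. -/
theorem isClique_insert_inr {C : Finset V} (hC : G.IsClique (C : Set V))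
    {a : Unit ⊕ (V ⊕ {e // e ∈ G.edgeFinset \ B})}
    (ha : ∀ x ∈ C, (hardnessGraph G B).Adj (Sum.inr a) (Sum.inl x)) :
    (hardnessGraph G B).IsClique
      ((insert (Sum.inr a) (C.map Function.Embedding.inl) :
        Finset (V ⊕ (Unit ⊕ (V ⊕ {e // e ∈ G.edgeFinset \ B})))) : Set _) := by
  rw [Finset.coe_insert, SimpleGraph.isClique_insert]
  refine ⟨?_, ?_⟩
  · intro p hp q hq hpq
    simp only [Finset.coe_map, Function.Embedding.inl_apply, Set.mem_image, Finset.mem_coe]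
      at hp hq
    obtain ⟨x, hx, rfl⟩ := hp
    obtain ⟨y, hy, rfl⟩ := hq
    exact adj_inl_inl.mpr (hC hx hy fun h => hpq (congrArg _ h))
  · intro p hp _
    obtain ⟨x, hx, rfl⟩ := Finset.mem_map.mp (Finset.mem_coe.mp hp)
    exact ha x hx

/-- A family of cliques of `G` covering `B` extends to an edge clique cover of the
hardness graph. -/
theorem exists_cover_of_annotated_cover (hBspan : ∀ x : V, ∃ e ∈ B, x ∈ e)
    {𝒞 : Finset (Finset V)} (hclique : ∀ C ∈ 𝒞, G.IsClique (C : Set V))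
    (hcover : ∀ e ∈ B, ∃ C ∈ 𝒞, ∀ x ∈ e, x ∈ C) :
    ∃ 𝒟 : Finset (Finset (V ⊕ (Unit ⊕ (V ⊕ {e // e ∈ G.edgeFinset \ B})))),
      IsEdgeCliqueCover (hardnessGraph G B) 𝒟 ∧
        𝒟.card ≤ Fintype.card V + (G.edgeFinset \ B).card + 𝒞.card := by
  let cone (a : Unit ⊕ (V ⊕ {e // e ∈ G.edgeFinset \ B})) (C : Finset V) :
      Finset (V ⊕ (Unit ⊕ (V ⊕ {e // e ∈ G.edgeFinset \ B}))) :=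
    insert (Sum.inr a) (C.map Function.Embedding.inl)
  have apex_mem (a C) : Sum.inr a ∈ cone a C := Finset.mem_insert_self _ _
  have base_mem {a C} {x : V} (hx : x ∈ C) : Sum.inl x ∈ cone a C := by simp [cone, hx]
  let 𝒟₁ := Finset.univ.image fun z => cone (Sum.inr z) (attachment G B z)
  let 𝒟₂ := 𝒞.image (cone (Sum.inl ()))
  have mem₁ (z) : cone (Sum.inr z) (attachment G B z) ∈ 𝒟₁ ∪ 𝒟₂ :=
    Finset.mem_union_left _ (Finset.mem_image_of_mem _ (Finset.mem_univ z))
  have mem₂ {C} (hC : C ∈ 𝒞) : cone (Sum.inl ()) C ∈ 𝒟₁ ∪ 𝒟₂ :=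
    Finset.mem_union_right _ (Finset.mem_image_of_mem _ hC)
  have covers_apex (a : Unit ⊕ (V ⊕ {e // e ∈ G.edgeFinset \ B})) (x : V)
      (h : (hardnessGraph G B).Adj (Sum.inr a) (Sum.inl x)) :
      ∃ D ∈ 𝒟₁ ∪ 𝒟₂, Sum.inr a ∈ D ∧ Sum.inl x ∈ D := by
    rcases a with ⟨⟩ | z
    · obtain ⟨e, he, hxe⟩ := hBspan x
      obtain ⟨C, hC, heC⟩ := hcover e he
      exact ⟨_, mem₂ hC, apex_mem _ _, base_mem (heC x hxe)⟩
    · exact ⟨_, mem₁ z, apex_mem _ _, base_mem (adj_attached.mp h)⟩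
  refine ⟨𝒟₁ ∪ 𝒟₂, ⟨?_, ?_⟩, ?_⟩
  · intro D hD
    rcases Finset.mem_union.mp hD with hD | hD
    · obtain ⟨z, -, rfl⟩ := Finset.mem_image.mp hD
      exact isClique_insert_inr (attachment_isClique z) fun x hx => adj_attached.mpr hx
    · obtain ⟨C, hC, rfl⟩ := Finset.mem_image.mp hD
      exact isClique_insert_inr (hclique C hC) fun x _ => adj_universal
  · rintro (x | a) (y | b) h
    · by_cases hxy : s(x, y) ∈ B
      · obtain ⟨C, hC, hCxy⟩ := hcover _ hxy
        exact ⟨_, mem₂ hC, base_mem (hCxy x (Sym2.mem_mk_left x y)),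
          base_mem (hCxy y (Sym2.mem_mk_right x y))⟩
      · have he : s(x, y) ∈ G.edgeFinset \ B := by simpa [hxy] using h
        exact ⟨_, mem₁ (Sum.inr ⟨_, he⟩), base_mem (by simp [attachment]),
          base_mem (by simp [attachment])⟩
    · obtain ⟨D, hD, hb, hx⟩ := covers_apex b x h.symm
      exact ⟨D, hD, hx, hb⟩
    · exact covers_apex a y h
    · exact absurd h not_adj_inr_inr
  · refine (Finset.card_union_le _ _).trans (Nat.add_le_add ?_ Finset.card_image_le)
    refine Finset.card_image_le.trans ?_
    rw [Finset.card_univ, Fintype.card_sum, Fintype.card_coe]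

/-- The cliques of an edge clique cover of the hardness graph that avoid all vertices `u_x`
and `w_e` restrict to a cover of `B`, and there are at least `|V| + |R|` others. -/
theorem exists_annotated_cover_of_cover (hB : B ⊆ G.edgeFinset)
    {𝒟 : Finset (Finset (V ⊕ (Unit ⊕ (V ⊕ {e // e ∈ G.edgeFinset \ B}))))}
    (h𝒟 : IsEdgeCliqueCover (hardnessGraph G B) 𝒟) :
    ∃ 𝒞 : Finset (Finset V), (∀ C ∈ 𝒞, G.IsClique (C : Set V)) ∧
      (∀ e ∈ B, ∃ C ∈ 𝒞, ∀ x ∈ e, x ∈ C) ∧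
        Fintype.card V + (G.edgeFinset \ B).card + 𝒞.card ≤ 𝒟.card := by
  obtain ⟨hclique, hcover⟩ := h𝒟
  let attached (D : Finset (V ⊕ (Unit ⊕ (V ⊕ {e // e ∈ G.edgeFinset \ B})))) : Prop :=
    ∃ z, Sum.inr (Sum.inr z) ∈ D
  have hattached (z : V ⊕ {e // e ∈ G.edgeFinset \ B}) :
      ∃ D ∈ 𝒟, Sum.inr (Sum.inr z) ∈ D := by
    obtain ⟨x, hx⟩ := attachment_nonempty z
    obtain ⟨D, hD, hz, -⟩ := hcover _ _ (adj_attached.mpr hx)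
    exact ⟨D, hD, hz⟩
  choose f hf𝒟 hf using hattached
  have f_inj : Function.Injective f := fun z w hzw => by
    by_contra hne
    exact not_adj_inr_inr
      (hclique _ (hf𝒟 w) (show Sum.inr (Sum.inr z) ∈ f w from hzw ▸ hf z) (hf w) (by simpa))
  classical
  refine ⟨({D ∈ 𝒟 | ¬ attached D}).image Finset.toLeft, ?_, ?_, ?_⟩
  · intro C hC
    obtain ⟨D, hD, rfl⟩ := Finset.mem_image.mp hC
    intro x hx y hy hxy
    exact adj_inl_inl.mp (hclique D (Finset.mem_filter.mp hD).1 (Finset.mem_toLeft.mp hx)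
      (Finset.mem_toLeft.mp hy) (by simpa))
  · intro e he
    induction e with
    | h x y =>
      have hadj : G.Adj x y := by simpa using hB he
      obtain ⟨D, hD, hx, hy⟩ := hcover _ _ (adj_inl_inl (B := B).mpr hadj)
      refine ⟨D.toLeft, Finset.mem_image_of_mem _ (Finset.mem_filter.mpr ⟨hD, ?_⟩), ?_⟩
      · rintro ⟨z, hz⟩
        exact mk_notMem_of_mem_attachment hadj.ne
          (adj_attached.mp (hclique D hD hz hx (by simp)))
          (adj_attached.mp (hclique D hD hz hy (by simp))) he
      · intro w hw
        rcases Sym2.mem_iff.mp hw with rfl | rfl <;> simpa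
  · rw [← Finset.card_filter_add_card_filter_not (s := 𝒟) attached]
    refine Nat.add_le_add ?_ Finset.card_image_le
    rw [← Fintype.card_coe (G.edgeFinset \ B), ← Fintype.card_sum, ← Finset.card_univ,
      ← Finset.card_image_of_injective _ f_inj]
    refine Finset.card_le_card fun D hD => ?_
    obtain ⟨z, -, rfl⟩ := Finset.mem_image.mp hD
    exact Finset.mem_filter.mpr ⟨hf𝒟 z, z, hf z⟩

end HardnessGraph

/-- If every vertex of `G` is incident to an edge of `B ⊆ E(G)` and `k ≥ 1`,
then there exist at most `k` cliques of `G` covering all edges of `B` iff `G'` has an edge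
clique cover with at most `|V(G)| + |R| + k` cliques, where `R = E(G) ∖ B`. -/
theorem annotated_cover_iff_hardnessGraph_cover {V : Type*} [Fintype V] [DecidableEq V]
    (G : SimpleGraph V) [DecidableRel G.Adj] (B : Finset (Sym2 V))
    (hB : B ⊆ G.edgeFinset) (hBspan : ∀ x : V, ∃ e ∈ B, x ∈ e)
    (k : ℕ) (hk : 1 ≤ k) :
    (∃ 𝒞 : Finset (Finset V), (∀ C ∈ 𝒞, G.IsClique (C : Set V)) ∧
        (∀ e ∈ B, ∃ C ∈ 𝒞, ∀ x ∈ e, x ∈ C) ∧ 𝒞.card ≤ k) ↔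
      (∃ 𝒟 : Finset (Finset (V ⊕ (Unit ⊕ (V ⊕ {e // e ∈ G.edgeFinset \ B})))),
        IsEdgeCliqueCover (hardnessGraph G B) 𝒟 ∧
          𝒟.card ≤ Fintype.card V + (G.edgeFinset \ B).card + k) := by
  constructor
  · rintro ⟨𝒞, hclique, hcover, hcard⟩
    obtain ⟨𝒟, h𝒟, hle⟩ :=
      HardnessGraph.exists_cover_of_annotated_cover hBspan hclique hcover
    exact ⟨𝒟, h𝒟, by omega⟩
  · rintro ⟨𝒟, h𝒟, hcard⟩
    obtain ⟨𝒞, hclique, hcover, hle⟩ := HardnessGraph.exists_annotated_cover_of_cover hB h𝒟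
    exact ⟨𝒞, hclique, hcover, by omega⟩
end

section
/- Let G be a finite simple bipartite graph with bipartition (V_1, V_2), where V_1 and V_2 are both nonempty, and let k ≥ 0 be an integer. Let G' be the graph obtained from G by adding all edges between distinct vertices within V_1 and all edges between distinct vertices within V_2, and adding two new vertices v_1 and v_2, where v_1 is adjacent exactly to the vertices of V_1 and v_2 is adjacent exactly to the vertices of V_2. Then α(G') = 2, and there exist at most k bicliques of G covering all edges of G if and only if G' has an edge clique cover with at most k + 2 cliques. -/
/-- For a bipartite graph `G` with bipartition `(V₁, V₁ᶜ)`, a biclique is a set `A` of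
vertices such that every vertex of `A ∩ V₁` is adjacent to every vertex of `A ∩ V₁ᶜ`. -/
def IsBiclique {V : Type*} (G : SimpleGraph V) (V₁ : Finset V) (A : Finset V) : Prop :=
  ∀ x ∈ A, ∀ y ∈ A, x ∈ V₁ → y ∉ V₁ → G.Adj x y

/-- The co-bipartite graph `G'` obtained from a bipartite `G` with bipartition
`(V₁, V₂ = V₁ᶜ)` (vertices `Sum.inl x`) by adding all edges within `V₁` and within `V₂`,
and adding two new vertices `v₁ = Sum.inr false` adjacent exactly to `V₁` and
`v₂ = Sum.inr true` adjacent exactly to `V₂`. -/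
def cobipGraph {V : Type*} (G : SimpleGraph V) (V₁ : Finset V) : SimpleGraph (V ⊕ Bool) :=
  SimpleGraph.fromRel fun a b =>
    match a, b with
    | Sum.inl x, Sum.inl y => G.Adj x y ∨ (x ∈ V₁ ∧ y ∈ V₁) ∨ (x ∉ V₁ ∧ y ∉ V₁)
    | Sum.inr c, Sum.inl x => (c = false ∧ x ∈ V₁) ∨ (c = true ∧ x ∉ V₁)
    | _, _ => False

namespace cobipGraph

variable {V : Type*} {G : SimpleGraph V} {V₁ : Finset V}

theorem adj_inl_inl {x y : V} : (cobipGraph G V₁).Adj (Sum.inl x) (Sum.inl y) ↔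
    x ≠ y ∧ (G.Adj x y ∨ (x ∈ V₁ ↔ y ∈ V₁)) := by
  have := G.adj_comm x y
  simp only [cobipGraph, SimpleGraph.fromRel_adj, ne_eq, Sum.inl.injEq]
  tauto

theorem adj_inr_inl {c : Bool} {x : V} : (cobipGraph G V₁).Adj (Sum.inr c) (Sum.inl x) ↔
    (c = false ↔ x ∈ V₁) := by
  cases c <;> simp [cobipGraph]

theorem adj_inl_inr {c : Bool} {x : V} : (cobipGraph G V₁).Adj (Sum.inl x) (Sum.inr c) ↔
    (c = false ↔ x ∈ V₁) := by
  rw [SimpleGraph.adj_comm, adj_inr_inl]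

theorem not_adj_inr_inr {c d : Bool} :
    ¬ (cobipGraph G V₁).Adj (Sum.inr c) (Sum.inr d) := by
  simp [cobipGraph]

variable (V₁) in
/-- The side of the co-bipartition of `cobipGraph G V₁` containing a vertex; `false` is the
side of `V₁`. -/
def side [DecidableEq V] : V ⊕ Bool → Bool :=
  Sum.elim (fun x => decide (x ∉ V₁)) id

theorem adj_of_side_eq [DecidableEq V] {a b : V ⊕ Bool} (hab : a ≠ b)
    (h : side V₁ a = side V₁ b) : (cobipGraph G V₁).Adj a b := by
  rcases a with x | c <;> rcases b with y | d
  · rw [adj_inl_inl]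
    simp only [side, Sum.elim_inl, decide_eq_decide, ne_eq, Sum.inl.injEq] at h hab
    tauto
  · rw [adj_inl_inr]
    cases d <;> simp_all [side]
  · rw [adj_inr_inl]
    cases c <;> simp_all [side]
  · simp_all [side]

theorem graphAlpha_eq_two [Fintype V] [DecidableEq V] : graphAlpha (cobipGraph G V₁) = 2 := by
  refine IsGreatest.csSup_eq ⟨⟨{Sum.inr false, Sum.inr true}, ?_, by simp⟩, ?_⟩
  · intro a ha b hb _
    simp only [Finset.coe_insert, Finset.coe_singleton, Set.mem_insert_iff,
      Set.mem_singleton_iff] at ha hb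
    rcases ha with rfl | rfl <;> rcases hb with rfl | rfl <;> exact not_adj_inr_inr
  · rintro n ⟨s, hs, rfl⟩
    by_contra! hcard
    obtain ⟨a, ha, b, hb, hab, h⟩ := Finset.exists_ne_map_eq_of_card_lt_of_maps_to
      (t := Finset.univ) (by simpa using hcard) (f := side V₁) (fun _ _ => Finset.mem_univ _)
    exact hs ha hb hab (adj_of_side_eq hab h)

theorem isClique_side [Fintype V] [DecidableEq V] (c : Bool) :
    (cobipGraph G V₁).IsClique
      (Finset.univ.filter (fun a => side V₁ a = c) : Finset (V ⊕ Bool)) := by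
  intro a ha b hb hab
  simp only [Finset.coe_filter, Finset.mem_univ, true_and, Set.mem_ofPred_eq] at ha hb
  exact adj_of_side_eq hab (ha.trans hb.symm)

theorem isClique_map_inl {A : Finset V} (hA : IsBiclique G V₁ A) :
    (cobipGraph G V₁).IsClique (A.map Function.Embedding.inl : Finset (V ⊕ Bool)) := by
  intro a ha b hb hab
  simp only [Finset.coe_map, Set.mem_image, Finset.mem_coe] at ha hb
  obtain ⟨x, hx, rfl⟩ := ha
  obtain ⟨y, hy, rfl⟩ := hb
  have h₁ := hA x hx y hy
  have h₂ := hA y hy x hx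
  rw [G.adj_comm] at h₂
  exact adj_inl_inl.2 ⟨fun h => hab (congrArg _ h), by tauto⟩

theorem isBiclique_toLeft {C : Finset (V ⊕ Bool)}
    (hC : (cobipGraph G V₁).IsClique (C : Set (V ⊕ Bool))) : IsBiclique G V₁ C.toLeft := by
  intro x hx y hy hx₁ hy₁
  rw [Finset.mem_toLeft] at hx hy
  have hxy : x ≠ y := by rintro rfl; exact hy₁ hx₁
  have := (adj_inl_inl.1 (hC hx hy (by simpa using hxy))).2
  tauto

theorem inr_mem_clique_iff {C : Finset (V ⊕ Bool)}
    (hC : (cobipGraph G V₁).IsClique (C : Set (V ⊕ Bool))) {c : Bool} {x : V}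
    (hc : Sum.inr c ∈ C) (hx : Sum.inl x ∈ C) : c = false ↔ x ∈ V₁ :=
  adj_inr_inl.1 (hC hc hx Sum.inr_ne_inl)

end cobipGraph

/-- For a bipartite graph `G` with nonempty bipartition sides `V₁, V₂ = V₁ᶜ`,
one has `α(G') = 2`, and `G` has at most `k` bicliques covering all its edges iff `G'` has
an edge clique cover with at most `k + 2` cliques. -/
theorem biclique_cover_iff_cobip_cover {V : Type*} [Fintype V] [DecidableEq V]
    (G : SimpleGraph V) (V₁ : Finset V)
    (h₁ : V₁.Nonempty) (h₂ : V₁ᶜ.Nonempty)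
    (hbip : ∀ u v, G.Adj u v → (u ∈ V₁ ↔ v ∉ V₁)) (k : ℕ) :
    graphAlpha (cobipGraph G V₁) = 2 ∧
      ((∃ 𝒜 : Finset (Finset V), (∀ A ∈ 𝒜, IsBiclique G V₁ A) ∧
          (∀ u v, G.Adj u v → ∃ A ∈ 𝒜, u ∈ A ∧ v ∈ A) ∧ 𝒜.card ≤ k) ↔
        (∃ 𝒞 : Finset (Finset (V ⊕ Bool)), IsEdgeCliqueCover (cobipGraph G V₁) 𝒞 ∧
          𝒞.card ≤ k + 2)) := by
  refine ⟨cobipGraph.graphAlpha_eq_two, ?_, ?_⟩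
  · rintro ⟨𝒜, hA, hcov, hcard⟩
    let S : Bool → Finset (V ⊕ Bool) := fun c =>
      Finset.univ.filter fun a => cobipGraph.side V₁ a = c
    refine ⟨insert (S false) (insert (S true)
      (𝒜.image fun A => A.map Function.Embedding.inl)), ⟨?_, ?_⟩, ?_⟩
    · intro C hC
      simp only [Finset.mem_insert, Finset.mem_image] at hC
      rcases hC with rfl | rfl | ⟨A, hA', rfl⟩
      · exact cobipGraph.isClique_side false
      · exact cobipGraph.isClique_side true
      · exact cobipGraph.isClique_map_inl (hA A hA')
    · intro a b hab
      by_cases h : cobipGraph.side V₁ a = cobipGraph.side V₁ b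
      · refine ⟨S (cobipGraph.side V₁ b), ?_, by simp [S, h], by simp [S]⟩
        cases cobipGraph.side V₁ b <;> simp
      · rcases a with x | c <;> rcases b with y | d
        · have hxy := (cobipGraph.adj_inl_inl.1 hab).2
          simp only [cobipGraph.side, Sum.elim_inl, decide_eq_decide] at h
          obtain ⟨A, hA', hx, hy⟩ := hcov x y (by tauto)
          exact ⟨A.map Function.Embedding.inl, Finset.mem_insert_of_mem
            (Finset.mem_insert_of_mem (Finset.mem_image_of_mem _ hA')),
            Finset.mem_map_of_mem _ hx, Finset.mem_map_of_mem _ hy⟩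
        · rw [cobipGraph.adj_inl_inr] at hab
          cases d <;> simp_all [cobipGraph.side]
        · rw [cobipGraph.adj_inr_inl] at hab
          cases c <;> simp_all [cobipGraph.side]
        · exact absurd hab cobipGraph.not_adj_inr_inr
    · have h₁ := Finset.card_insert_le (S false) (insert (S true)
        (𝒜.image fun A => A.map Function.Embedding.inl))
      have h₂ := Finset.card_insert_le (S true) (𝒜.image fun A => A.map Function.Embedding.inl)
      have h₃ : (𝒜.image fun A => A.map (Function.Embedding.inl (β := Bool))).card ≤ 𝒜.card :=
        Finset.card_image_le
      lia
  · rintro ⟨𝒞, ⟨hC, hcov⟩, hcard⟩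
    obtain ⟨x₁, hx₁⟩ := h₁
    obtain ⟨x₂, hx₂⟩ := h₂
    rw [Finset.mem_compl] at hx₂
    obtain ⟨C₁, hC₁, hv₁, -⟩ := hcov (Sum.inr false) (Sum.inl x₁)
      (cobipGraph.adj_inr_inl.2 (by simpa using hx₁))
    obtain ⟨C₂, hC₂, hv₂, -⟩ := hcov (Sum.inr true) (Sum.inl x₂)
      (cobipGraph.adj_inr_inl.2 (by simpa using hx₂))
    have hne : C₂ ≠ C₁ := by
      rintro rfl
      exact cobipGraph.not_adj_inr_inr (hC C₂ hC₂ hv₁ hv₂ (by simp))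
    refine ⟨((𝒞.erase C₁).erase C₂).image Finset.toLeft, ?_, ?_, ?_⟩
    · intro A hA
      obtain ⟨C, hC', rfl⟩ := Finset.mem_image.1 hA
      exact cobipGraph.isBiclique_toLeft
        (hC C (Finset.mem_of_mem_erase (Finset.mem_of_mem_erase hC')))
    · intro u v huv
      obtain ⟨C, hC', hu, hv⟩ := hcov (Sum.inl u) (Sum.inl v)
        (cobipGraph.adj_inl_inl.2 ⟨huv.ne, Or.inl huv⟩)
      have hside := hbip u v huv
      have hnot (c : Bool) : Sum.inr c ∉ C := fun hc => by
        have h₁ := cobipGraph.inr_mem_clique_iff (hC C hC') hc hu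
        have h₂ := cobipGraph.inr_mem_clique_iff (hC C hC') hc hv
        tauto
      refine ⟨C.toLeft, Finset.mem_image_of_mem _ ?_, by simpa using hu, by simpa using hv⟩
      refine Finset.mem_erase.2 ⟨?_, Finset.mem_erase.2 ⟨?_, hC'⟩⟩
      · rintro rfl
        exact hnot _ hv₂
      · rintro rfl
        exact hnot _ hv₁
    · refine Finset.card_image_le.trans ?_
      rw [Finset.card_erase_of_mem (Finset.mem_erase.2 ⟨hne, hC₂⟩), Finset.card_erase_of_mem hC₁]
      lia
end

section
/- For all integers a and b with a ≥ 3 and b ≥ 3, the binomial coefficient satisfies C(a + b, b)^2 ≤ 2^{ab} (equivalently, C(a + b, b) ≤ 2^{ab/2}). -/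
theorem add_four_sq_le (a : ℕ) : (a + 4) ^ 2 ≤ 16 * 2 ^ a := by
  induction a with
  | zero => norm_num
  | succ n ih =>
    rw [pow_succ 2 n]
    nlinarith [Nat.zero_le n, Nat.zero_le (n ^ 2)]

theorem add_add_one_sq_le (a b : ℕ) (hb : 3 ≤ b) :
    (a + b + 1) ^ 2 ≤ 2 ^ a * (b + 1) ^ 2 := by
  have h : 4 * (a + b + 1) ≤ (b + 1) * (a + 4) := by nlinarith
  have h2 := Nat.pow_le_pow_left h 2
  rw [mul_pow, mul_pow] at h2
  have h3 := Nat.mul_le_mul_left ((b + 1) ^ 2) (add_four_sq_le a)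
  linarith

theorem choose_sq_le_two_pow_succ (a b : ℕ) (hb : 3 ≤ b)
    (h : (Nat.choose (a + b) b) ^ 2 ≤ 2 ^ (a * b)) :
    (Nat.choose (a + (b + 1)) (b + 1)) ^ 2 ≤ 2 ^ (a * (b + 1)) := by
  refine Nat.le_of_mul_le_mul_right ?_ (show 0 < (b + 1) ^ 2 by positivity)
  calc (Nat.choose (a + (b + 1)) (b + 1)) ^ 2 * (b + 1) ^ 2
      = (a + b + 1) ^ 2 * (Nat.choose (a + b) b) ^ 2 := by
        rw [← mul_pow, ← mul_pow, ← add_assoc, Nat.add_one_mul_choose_eq]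
    _ ≤ (2 ^ a * (b + 1) ^ 2) * 2 ^ (a * b) := Nat.mul_le_mul (add_add_one_sq_le a b hb) h
    _ = 2 ^ (a * (b + 1)) * (b + 1) ^ 2 := by ring

/-- For all integers `a, b ≥ 3`, `C(a + b, b)² ≤ 2 ^ (a * b)`,
equivalently `C(a + b, b) ≤ 2 ^ (a * b / 2)`. -/
theorem choose_sq_le_two_pow (a b : ℕ) (ha : 3 ≤ a) (hb : 3 ≤ b) :
    (Nat.choose (a + b) b) ^ 2 ≤ 2 ^ (a * b) := by
  induction b, hb using Nat.le_induction with
  | base =>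
    rw [← Nat.choose_symm_add, add_comm, mul_comm]
    induction a, ha using Nat.le_induction with
    | base => decide
    | succ n hn ih => exact choose_sq_le_two_pow_succ 3 n hn ih
  | succ n hn ih => exact choose_sq_le_two_pow_succ a n hn ih
end

section
/- For all integers p, q ≥ 1, every finite simple graph with at least C(p + q − 2, p − 1) vertices contains a clique with p vertices or an independent set with q vertices. -/
/-- The Erdős–Szekeres bound relative to a finset of vertices: independent sets are expressed as
cliques of the complement. -/
theorem SimpleGraph.exists_isNClique_or_isNClique_compl_of_choose_le {V : Type*}
    (G : SimpleGraph V) (a b : ℕ) (A : Finset V) (hA : (a + b).choose a ≤ A.card) :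
    (∃ s ⊆ A, G.IsNClique (a + 1) s) ∨ ∃ s ⊆ A, Gᶜ.IsNClique (b + 1) s := by
  classical
  have hpos : 0 < A.card := (Nat.choose_pos (Nat.le_add_right a b)).trans_le hA
  obtain ⟨v, hv⟩ := Finset.card_pos.mp hpos
  induction a generalizing b A v with
  | zero => exact .inl ⟨{v}, by simpa using hv, by simp⟩
  | succ a iha =>
    induction b generalizing A v with
    | zero => exact .inr ⟨{v}, by simpa using hv, by simp⟩
    | succ b ihb =>
      let N := (A.erase v).filter (G.Adj v)
      let M := (A.erase v).filter (¬ G.Adj v ·)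
      have hNA : N ⊆ A := (Finset.filter_subset _ _).trans (Finset.erase_subset _ _)
      have hMA : M ⊆ A := (Finset.filter_subset _ _).trans (Finset.erase_subset _ _)
      have hsum : N.card + M.card + 1 = A.card := by
        rw [Finset.card_filter_add_card_filter_not, Finset.card_erase_add_one hv]
      have hchoose : (a + 1 + (b + 1)).choose (a + 1) =
          (a + (b + 1)).choose a + (a + 1 + b).choose (a + 1) := by
        rw [show a + 1 + (b + 1) = (a + (b + 1)) + 1 by ring, Nat.choose_succ_succ,
          show a + (b + 1) = a + 1 + b by ring]
      by_cases hN : (a + (b + 1)).choose a ≤ N.card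
      · have hNpos : 0 < N.card := (Nat.choose_pos (Nat.le_add_right _ _)).trans_le hN
        obtain ⟨w, hw⟩ := Finset.card_pos.mp hNpos
        obtain ⟨s, hs, hc⟩ | ⟨s, hs, hc⟩ := iha (b + 1) N hN hNpos w hw
        · exact .inl ⟨insert v s, Finset.insert_subset hv (hs.trans hNA),
            hc.insert fun x hx => (Finset.mem_filter.mp (hs hx)).2⟩
        · exact .inr ⟨s, hs.trans hNA, hc⟩
      · have hM : (a + 1 + b).choose (a + 1) ≤ M.card := by omega
        have hMpos : 0 < M.card := (Nat.choose_pos (Nat.le_add_right _ _)).trans_le hM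
        obtain ⟨w, hw⟩ := Finset.card_pos.mp hMpos
        obtain ⟨s, hs, hc⟩ | ⟨s, hs, hc⟩ := ihb M hM hMpos w hw
        · exact .inl ⟨s, hs.trans hMA, hc⟩
        · refine .inr ⟨insert v s, Finset.insert_subset hv (hs.trans hMA),
            hc.insert fun x hx => ?_⟩
          obtain ⟨hxA, hvx⟩ := Finset.mem_filter.mp (hs hx)
          exact (G.compl_adj v x).mpr ⟨(Finset.ne_of_mem_erase hxA).symm, hvx⟩

/-- Erdős–Szekeres bound for Ramsey's theorem: For `p, q ≥ 1`, every finite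
simple graph with at least `C(p + q - 2, p - 1)` vertices contains a clique with `p`
vertices or an independent set with `q` vertices. -/
theorem ramsey_clique_or_indep {V : Type*} [Fintype V] (G : SimpleGraph V)
    (p q : ℕ) (hp : 1 ≤ p) (hq : 1 ≤ q)
    (hcard : Nat.choose (p + q - 2) (p - 1) ≤ Fintype.card V) :
    (∃ s : Finset V, G.IsClique (s : Set V) ∧ s.card = p) ∨
      (∃ s : Finset V, IsIndepFinset G s ∧ s.card = q) := by
  obtain ⟨a, rfl⟩ := Nat.exists_eq_add_of_le' hp
  obtain ⟨b, rfl⟩ := Nat.exists_eq_add_of_le' hq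
  rw [show a + 1 + (b + 1) - 2 = a + b by omega, Nat.add_sub_cancel] at hcard
  obtain ⟨s, -, hs⟩ | ⟨s, -, hs⟩ :=
    G.exists_isNClique_or_isNClique_compl_of_choose_le a b Finset.univ hcard
  · exact .inl ⟨s, hs.isClique, hs.card_eq⟩
  · exact .inr ⟨s, (SimpleGraph.isClique_compl G).mp hs.isClique, hs.card_eq⟩
end
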